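/- arXiv:1410.7934 — 2 statements merged into one kernel-verified Lean document; each statement's English description precedes it below -/
import Mathlib

section
/- Assume the Riemann hypothesis. Then for every α > 1, every f in the Müntz class M_α, every x > 0 and every σ with 1/2 < σ < 1, the summation formula Σ_{n=1}^∞ λ(n) f(nx) = Σ_{n=1}^∞ (1/(2πi)) ∫_{σ−i∞}^{σ+i∞} (f*(s)/ζ(s)) (n² x)^{−s} ds holds. -/
open MeasureTheory Filter Asymptotics Set Complex

noncomputable section

/-- The Mellin transform of `f`. -/
def mellinT (f : ℝ → ℂ) (s : ℂ) : ℂ := ∫ x in Ioi (0:ℝ), (x : ℂ) ^ (s - 1) * f x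

/-- The Müntz class `M_α`. -/
def MuntzClass (α : ℝ) (f : ℝ → ℂ) : Prop :=
  ContDiffOn ℝ 2 f (Ici 0) ∧
  ∀ j : ℕ, j ≤ 2 →
    (iteratedDerivWithin j f (Ici 0)) =O[atTop] fun x : ℝ => x ^ (-(α + (j : ℝ)))

/-- The Möbius transformation `(Θf)(x) = ∑ f(nx)`. -/
def thetaOp (f : ℝ → ℂ) (x : ℝ) : ℂ := ∑' n : ℕ, f ((n + 1 : ℝ) * x)

/-- The Müntz operator. -/
def muntzOp (f : ℝ → ℂ) (x : ℝ) : ℂ :=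
  thetaOp f x - (x : ℂ)⁻¹ * ∫ y in Ioi (0:ℝ), f y

/-- `(1/(2πi)) ∫_{σ-i∞}^{σ+i∞} g(s) ds`. -/
def lineIntegral (g : ℂ → ℂ) (σ : ℝ) : ℂ :=
  (2 * Real.pi)⁻¹ • ∫ t : ℝ, g (σ + t * Complex.I)

/-- The Fourier cosine transform. -/
def fourierCos (f : ℝ → ℂ) (x : ℝ) : ℂ :=
  (Real.sqrt (2 / Real.pi) : ℂ) * ∫ t in Ioi (0:ℝ), f t * (Real.cos (x * t) : ℂ)

/-- The reduced Möbius operator. -/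
def thetaHat (f : ℝ → ℂ) (x : ℝ) : ℂ :=
  ∑' n : ℕ, ((|ArithmeticFunction.moebius (n + 1)| : ℤ) : ℂ) * f ((n + 1 : ℝ) * x)

/-- The Voronoi operator. -/
def voronoiOp (f : ℝ → ℂ) (x : ℝ) : ℂ :=
  (∑' n : ℕ, ((n + 1 : ℕ).divisors.card : ℂ) * f ((n + 1 : ℝ) * x)) -
    ∫ y in Ioi (0:ℝ), f (x * y) *
      ((Real.log y + 2 * Real.eulerMascheroniConstant : ℝ) : ℂ)


/-- fractional part cut off below one -/
def fracCut (t : ℝ) : ℂ := if 1 < t then ((Int.fract t : ℝ) : ℂ) else 0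

lemma fracCut_meas : Measurable fracCut := by
  unfold fracCut
  refine Measurable.ite measurableSet_Ioi ?_ measurable_const
  exact Complex.measurable_ofReal.comp measurable_fract

lemma fracCut_norm_le (t : ℝ) : ‖fracCut t‖ ≤ 1 := by
  unfold fracCut
  split_ifs
  · rw [Complex.norm_real, Real.norm_eq_abs, abs_of_nonneg (Int.fract_nonneg t)]
    exact (Int.fract_lt_one t).le
  · simp

lemma fracCut_locInt : LocallyIntegrableOn fracCut (Ioi 0) := by
  have h : LocallyIntegrable fracCut volume := by
    refine (locallyIntegrable_const (1:ℝ)).mono fracCut_meas.aestronglyMeasurable ?_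
    exact Eventually.of_forall fun t => by simpa using fracCut_norm_le t
  exact h.locallyIntegrableOn _

lemma fracCut_top : fracCut =O[atTop] (fun x : ℝ => x ^ (-(0:ℝ))) := by
  refine IsBigO.of_bound 1 (Eventually.of_forall fun t => ?_)
  simpa using fracCut_norm_le t

lemma fracCut_bot (b : ℝ) : fracCut =O[nhdsWithin 0 (Ioi 0)] (fun x : ℝ => x ^ (-b)) := by
  refine IsBigO.of_bound 0 ?_
  have : Iio (1:ℝ) ∈ nhdsWithin (0:ℝ) (Ioi 0) := mem_nhdsWithin_of_mem_nhds (Iio_mem_nhds one_pos)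
  filter_upwards [this] with t ht
  have : ¬ (1 < t) := not_lt.mpr (le_of_lt ht)
  simp [fracCut, this]

lemma fracCut_mellin_diff {s : ℂ} (hs : s.re < 0) : DifferentiableAt ℂ (mellin fracCut) s :=
  mellin_differentiableAt_of_isBigO_rpow (a := 0) (b := s.re - 1) fracCut_locInt fracCut_top hs
    (fracCut_bot _) (by linarith)

lemma fracCut_mellinConv {s : ℂ} (hs : s.re < 0) : MellinConvergent fracCut s :=
  mellinConvergent_of_isBigO_rpow (a := 0) (b := s.re - 1) fracCut_locInt fracCut_top hs
    (fracCut_bot _) (by linarith)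

lemma fracCut_mellin_eq (s : ℂ) : mellin fracCut s =
    ∫ t in Ioi (1:ℝ), (t:ℂ) ^ (s - 1) * ((Int.fract t : ℝ) : ℂ) := by
  unfold mellin
  rw [← integral_indicator measurableSet_Ioi, ← integral_indicator measurableSet_Ioi]
  congr 1
  ext t
  by_cases h1 : 1 < t
  · have h0 : 0 < t := by linarith
    simp [indicator, h1, h0, fracCut]
  · simp [indicator, h1, fracCut]

lemma fracCut_mellin_bound {s : ℂ} (hs : 0 < s.re) : ‖mellin fracCut (-s)‖ ≤ 1 / s.re := by
  rw [fracCut_mellin_eq]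
  have hint : IntegrableOn (fun t : ℝ => t ^ (-s.re - 1)) (Ioi 1) :=
    integrableOn_Ioi_rpow_of_lt (by linarith) one_pos
  have h2 : ∫ t in Ioi (1:ℝ), t ^ (-s.re - 1) = 1 / s.re := by
    rw [integral_Ioi_rpow_of_lt (by linarith) one_pos]
    simp
  rw [← h2]
  refine norm_integral_le_of_norm_le hint ?_
  filter_upwards [ae_restrict_mem measurableSet_Ioi] with t ht
  have ht0 : (0:ℝ) < t := lt_trans one_pos ht
  rw [norm_mul, Complex.norm_cpow_eq_rpow_re_of_pos ht0, Complex.norm_real, Real.norm_eq_abs,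
    abs_of_nonneg (Int.fract_nonneg t)]
  simp only [sub_re, neg_re, one_re]
  exact mul_le_of_le_one_right (by positivity) (Int.fract_lt_one t).le

lemma zeta_formula_gt {s : ℂ} (hs : 1 < s.re) :
    riemannZeta₁ s = s - s * (s - 1) * mellin fracCut (-s) := by
  have hs1 : s ≠ 1 := by rintro rfl; simp at hs
  have h1 : riemannZeta s = s * ∫ t in Ioi (1 : ℝ), ((⌊t⌋₊ : ℕ) : ℂ) * (t:ℂ) ^ (-(s + 1)) := by
    have := LSeries_eq_mul_integral_of_nonneg (fun _ => (1:ℝ)) zero_le_one hs ?_ (by simp)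
    · rw [← LSeries_one_eq_riemannZeta hs]
      simpa using! this
    · simp only [Finset.sum_const, Nat.card_Icc, add_tsub_cancel_right, nsmul_eq_mul, mul_one,
        Real.rpow_one]
      exact isBigO_refl _ _
  have hI1 : IntegrableOn (fun t : ℝ => (t:ℂ) ^ (-s)) (Ioi 1) :=
    integrableOn_Ioi_cpow_of_lt (by simpa using hs) one_pos
  have hv : ∫ t in Ioi (1:ℝ), (t:ℂ) ^ (-s) = 1 / (s - 1) := by
    rw [integral_Ioi_cpow_of_lt (by simpa using hs) one_pos]
    have : s - 1 ≠ 0 := sub_ne_zero.mpr hs1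
    have h' : -s + 1 ≠ 0 := by intro h; apply this; linear_combination -h
    simp only [ofReal_one, one_cpow]
    field_simp
    ring
  have hI2 : IntegrableOn (fun t : ℝ => (t:ℂ) ^ (-s - 1) * ((Int.fract t : ℝ) : ℂ)) (Ioi 1) := by
    have := fracCut_mellinConv (s := -s) (by simp; linarith)
    have h3 : IntegrableOn (fun t : ℝ => (t:ℂ) ^ (-s - 1) • fracCut t) (Ioi 1) :=
      this.mono_set (Ioi_subset_Ioi zero_le_one)
    refine h3.congr_fun ?_ measurableSet_Ioi
    intro t ht
    have : 1 < t := ht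
    simp [fracCut, this]
  have h4 : ∫ t in Ioi (1 : ℝ), ((⌊t⌋₊ : ℕ) : ℂ) * (t:ℂ) ^ (-(s + 1)) =
      1 / (s - 1) - mellin fracCut (-s) := by
    rw [fracCut_mellin_eq, ← hv, ← integral_sub hI1 hI2]
    refine setIntegral_congr_fun measurableSet_Ioi ?_
    intro t ht
    have ht0 : (0:ℝ) < t := lt_trans one_pos ht
    have ht' : (t:ℂ) ≠ 0 := by exact_mod_cast ht0.ne'
    have e1 : (t:ℂ) ^ (-s) = t * (t:ℂ) ^ (-s - 1) := by
      rw [cpow_sub _ _ ht', cpow_one]; field_simp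
    have e2 : ((⌊t⌋₊ : ℕ) : ℂ) = (t:ℂ) - ((Int.fract t : ℝ) : ℂ) := by
      have := Int.fract_add_floor t
      have h5 : ((⌊t⌋₊ : ℕ) : ℝ) = (⌊t⌋ : ℝ) := natCast_floor_eq_intCast_floor ht0.le
      have : ((⌊t⌋₊ : ℕ) : ℝ) = t - Int.fract t := by rw [h5]; linarith
      exact_mod_cast congrArg (fun r : ℝ => (r:ℂ)) this
    simp only []
    rw [e1, e2, show -(s+1) = -s - 1 by ring]
    ring
  have h5 : riemannZeta₁ s = (s - 1) * riemannZeta s := by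
    rw [riemannZeta_eq_inv_sub_mul hs1]
    field_simp [sub_ne_zero.mpr hs1]
  rw [h5, h1, h4]
  field_simp [sub_ne_zero.mpr hs1]
  

lemma zeta_formula {s : ℂ} (hs : 0 < s.re) :
    riemannZeta₁ s = s - s * (s - 1) * mellin fracCut (-s) := by
  have hU : IsOpen {z : ℂ | 0 < z.re} := isOpen_lt continuous_const continuous_re
  have hc : IsPreconnected {z : ℂ | 0 < z.re} := (convex_halfSpace_re_gt 0).isPreconnected
  have hA : AnalyticOnNhd ℂ riemannZeta₁ {z : ℂ | 0 < z.re} :=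
    differentiable_riemannZeta₁.differentiableOn.analyticOnNhd hU
  have hB : AnalyticOnNhd ℂ (fun s => s - s * (s - 1) * mellin fracCut (-s)) {z : ℂ | 0 < z.re} := by
    refine DifferentiableOn.analyticOnNhd (fun z hz => ?_) hU
    have h1 : DifferentiableAt ℂ (fun s : ℂ => mellin fracCut (-s)) z :=
      DifferentiableAt.comp (g := mellin fracCut) (f := fun s : ℂ => -s) z (fracCut_mellin_diff (s := -z) (by simpa using hz)) (by fun_prop)
    have : DifferentiableAt ℂ (fun s => s - s * (s - 1) * mellin fracCut (-s)) z := by fun_prop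
    exact this.differentiableWithinAt
  have h2 : (2:ℂ) ∈ {z : ℂ | 0 < z.re} := by simp
  refine hA.eqOn_of_preconnected_of_eventuallyEq hB hc h2 ?_ hs
  have : {z : ℂ | 1 < z.re} ∈ nhds (2:ℂ) :=
    (isOpen_lt continuous_const continuous_re).mem_nhds (by simp)
  filter_upwards [this] with z hz using zeta_formula_gt hz

/-- the normalised zeta function -/
def zG (s : ℂ) : ℂ := riemannZeta₁ s / s

lemma zG_norm_le {s : ℂ} (hs : 0 < s.re) : ‖zG s‖ ≤ 1 + ‖s - 1‖ / s.re := by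
  have hs0 : s ≠ 0 := by rintro rfl; simp at hs
  have : zG s = 1 - (s - 1) * mellin fracCut (-s) := by
    rw [zG, zeta_formula hs]; field_simp
  rw [this]
  refine (norm_sub_le _ _).trans ?_
  rw [norm_one, norm_mul, div_eq_mul_one_div]
  gcongr
  exact fracCut_mellin_bound hs

lemma zG_eq {s : ℂ} (hs1 : s ≠ 1) : zG s = riemannZeta s * ((s - 1) / s) := by
  rw [zG, riemannZeta_eq_inv_sub_mul hs1]
  field_simp [sub_ne_zero.mpr hs1]

lemma zG_diff {s : ℂ} (hs : s ≠ 0) : DifferentiableAt ℂ zG s := by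
  unfold zG
  exact (differentiable_riemannZeta₁ s).div differentiableAt_id hs

lemma zG_ne_zero
    (hRH : ∀ s : ℂ, riemannZeta s = 0 → 0 < s.re → s.re < 1 → s.re = 1 / 2)
    {s : ℂ} (hs : 1 / 2 < s.re) : zG s ≠ 0 := by
  have hs0 : s ≠ 0 := by rintro rfl; norm_num at hs
  by_cases h1 : s = 1
  · subst h1; simp [zG]
  · rw [zG_eq h1]
    refine mul_ne_zero ?_ (div_ne_zero (sub_ne_zero.mpr h1) hs0)
    intro h
    rcases lt_or_ge s.re 1 with h2 | h2
    · have := hRH s h (by linarith) h2; linarith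
    · exact riemannZeta_ne_zero_of_one_le_re h2 h



/-- Hadamard three circles plus Borel–Carathéodory. -/
lemma three_circles {h : ℂ → ℂ} {R r1 r2 r3 M1 M3 : ℝ} (hr1 : 0 < r1) (h12 : r1 < r2)
    (h23 : r2 < r3) (h3R : r3 < R) (hd : DifferentiableOn ℂ h (Metric.ball 0 R))
    (hM1 : 0 < M1) (hM : M1 ≤ M3)
    (h1 : ∀ z : ℂ, ‖z‖ ≤ r1 → ‖h z‖ ≤ M1) (h3 : ∀ z : ℂ, ‖z‖ ≤ r3 → ‖h z‖ ≤ M3)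
    {z : ℂ} (hz : ‖z‖ ≤ r2) :
    ‖h z‖ ≤ M1 ^ (1 - (Real.log r2 - Real.log r1) / (Real.log r3 - Real.log r1)) *
      M3 ^ ((Real.log r2 - Real.log r1) / (Real.log r3 - Real.log r1)) := by
  have hl12 : Real.log r1 < Real.log r2 := Real.log_lt_log hr1 h12
  have hl23 : Real.log r2 < Real.log r3 := Real.log_lt_log (by linarith) h23
  have hM3 : 0 < M3 := by linarith
  set θ := (Real.log r2 - Real.log r1) / (Real.log r3 - Real.log r1) with hθ
  have hθ0 : 0 ≤ θ := div_nonneg (by linarith) (by linarith)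
  have key : ∀ t : ℝ, M1 ^ (1 - t) * M3 ^ t = M1 * (M3 / M1) ^ t := by
    intro t
    rw [Real.div_rpow hM3.le hM1.le, Real.rpow_sub hM1, Real.rpow_one]
    field_simp
  rw [key]
  have hone : 1 ≤ M3 / M1 := by rw [le_div_iff₀ hM1]; linarith
  rcases le_or_gt ‖z‖ r1 with hz1 | hz1
  · exact (h1 z hz1).trans (le_mul_of_one_le_right hM1.le (Real.one_le_rpow hone hθ0))
  · have hz0 : z ≠ 0 := by rintro rfl; simp at hz1; linarith
    have hzp : 0 < ‖z‖ := norm_pos_iff.mpr hz0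
    have hexp : Complex.exp (Complex.log z) = z := Complex.exp_log hz0
    have hre : (Complex.log z).re = Real.log ‖z‖ := Complex.log_re z
    have hmem : ∀ w : ℂ, w.re ≤ Real.log r3 → ‖Complex.exp w‖ ≤ r3 := by
      intro w hw
      rw [Complex.norm_exp, ← Real.exp_log (show 0 < r3 by linarith)]
      exact Real.exp_le_exp.mpr hw
    have := HadamardThreeLines.norm_le_interp_of_mem_verticalClosedStrip'
      (f := fun w => h (Complex.exp w)) (z := Complex.log z) (a := M1) (b := M3)
      (l := Real.log r1) (u := Real.log r3) (by linarith) ?_ ?_ ?_ ?_ ?_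
    · rw [hexp, hre, key] at this
      refine this.trans ?_
      refine mul_le_mul_of_nonneg_left (Real.rpow_le_rpow_of_exponent_le hone ?_) hM1.le
      exact div_le_div_of_nonneg_right (by linarith [Real.log_le_log hzp hz]) (by linarith)
    · simp only [HadamardThreeLines.verticalClosedStrip, mem_preimage, mem_Icc, hre]
      exact ⟨Real.log_le_log hr1 hz1.le, Real.log_le_log hzp (by linarith)⟩
    · refine DifferentiableOn.diffContOnCl fun w hw => ?_
      have hcl : closure (HadamardThreeLines.verticalStrip (Real.log r1) (Real.log r3)) ⊆
          HadamardThreeLines.verticalClosedStrip (Real.log r1) (Real.log r3) := by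
        refine closure_minimal (preimage_mono Ioo_subset_Icc_self) ?_
        exact isClosed_Icc.preimage continuous_re
      have hw' := hmem w (hcl hw).2
      have hb : Complex.exp w ∈ Metric.ball (0:ℂ) R := by
        rw [mem_ball_zero_iff]; linarith
      have : DifferentiableAt ℂ h (Complex.exp w) :=
        (hd _ hb).differentiableAt (Metric.isOpen_ball.mem_nhds hb)
      exact (DifferentiableAt.comp (g := h) (f := Complex.exp) w this
        Complex.differentiableAt_exp).differentiableWithinAt
    · refine ⟨M3, ?_⟩
      rintro _ ⟨w, hw, rfl⟩
      exact h3 _ (hmem w hw.2)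
    · intro w hw
      refine h1 _ ?_
      have : w.re = Real.log r1 := hw
      rw [Complex.norm_exp, this, Real.exp_log hr1]
    · intro w hw
      exact h3 _ (hmem w (le_of_eq hw))

lemma rpow_interp_le {θ M1 η : ℝ} (hθ0 : 0 ≤ θ) (hθ1 : θ < 1) (hM : 0 < M1) (hη : 0 < η) :
    ∃ C : ℝ, ∀ y : ℝ, 0 ≤ y → M1 ^ (1 - θ) * y ^ θ ≤ η * y + C := by
  refine ⟨(1 - θ) * (M1 * η ^ (-(θ / (1 - θ)))), fun y hy => ?_⟩
  have h := Real.geom_mean_le_arith_mean2_weighted (w₁ := 1 - θ) (w₂ := θ)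
    (p₁ := M1 * η ^ (-(θ / (1 - θ)))) (p₂ := η * y) (by linarith) hθ0 (by positivity)
    (by positivity) (by ring)
  have e : (M1 * η ^ (-(θ / (1 - θ)))) ^ (1 - θ) * (η * y) ^ θ = M1 ^ (1 - θ) * y ^ θ := by
    rw [Real.mul_rpow hM.le (by positivity), Real.mul_rpow hη.le hy, ← Real.rpow_mul hη.le]
    have : -(θ / (1 - θ)) * (1 - θ) = -θ := by
      field_simp [show (1 - θ) ≠ 0 by linarith]
    rw [this, Real.rpow_neg hη.le]
    field_simp
  rw [e] at h
  have : θ * (η * y) ≤ η * y := mul_le_of_le_one_left (by positivity) hθ1.le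
  linarith

/-- local logarithm -/
lemma exists_local_log {G : ℂ → ℂ} {c : ℂ} {R : ℝ} (hR : 0 < R)
    (hd : DifferentiableOn ℂ G (Metric.ball c R)) (h0 : ∀ z ∈ Metric.ball c R, G z ≠ 0) :
    ∃ h : ℂ → ℂ, DifferentiableOn ℂ h (Metric.ball 0 R) ∧ h 0 = Complex.log (G c) ∧
      ∀ z ∈ Metric.ball (0:ℂ) R, Complex.exp (h z) = G (c + z) := by
  have hd' : DifferentiableOn ℂ (fun z => deriv G z / G z) (Metric.ball c R) :=
    (hd.deriv Metric.isOpen_ball).div hd h0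
  obtain ⟨g, hg0, hg⟩ := hd'.isExactOn_ball.with_val_at c (Complex.log (G c))
  have hcm : c ∈ Metric.ball c R := Metric.mem_ball_self hR
  have hshift : ∀ z ∈ Metric.ball (0:ℂ) R, c + z ∈ Metric.ball c R := by
    intro z hz; simpa [Metric.mem_ball, dist_eq_norm] using hz
  have hconst : ∀ z ∈ Metric.ball c R, Complex.exp (g z) = G z := by
    have hD : ∀ z ∈ Metric.ball c R, HasDerivAt (fun z => G z * Complex.exp (-g z)) 0 z := by
      intro z hz
      have h1 : HasDerivAt G (deriv G z) z :=
        ((hd z hz).differentiableAt (Metric.isOpen_ball.mem_nhds hz)).hasDerivAt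
      have h2 := h1.mul ((hg z hz).neg.cexp)
      convert! h2 using 1
      field_simp [h0 z hz]
      ring
    intro z hz
    have := (convex_ball c R).is_const_of_fderivWithin_eq_zero (𝕜 := ℂ)
      (f := fun z => G z * Complex.exp (-g z))
      (fun w hw => (hD w hw).differentiableAt.differentiableWithinAt) ?_ hz hcm
    · simp only [hg0] at this
      rw [Complex.exp_neg (Complex.log _), Complex.exp_log (h0 c hcm), mul_inv_cancel₀ (h0 c hcm),
        Complex.exp_neg] at this
      field_simp at this
      exact this.symm
    · intro w hw
      have := (hD w hw).hasDerivWithinAt (s := Metric.ball c R)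
      rw [this.hasFDerivWithinAt.fderivWithin (Metric.isOpen_ball.uniqueDiffWithinAt hw)]
      ext; simp
  refine ⟨fun z => g (c + z), ?_, by simpa using hg0, fun z hz => hconst _ (hshift z hz)⟩
  intro z hz
  have : DifferentiableAt ℂ g (c + z) := (hg _ (hshift z hz)).differentiableAt
  exact (DifferentiableAt.comp (g := g) (f := fun z => c + z) z this
    (by fun_prop)).differentiableWithinAt


lemma zeta_consts : ∃ Z : ℝ, 1 ≤ Z ∧ ∀ s : ℂ, 5 / 4 ≤ s.re →
    ‖riemannZeta s‖ ≤ Z ∧ ‖(riemannZeta s)⁻¹‖ ≤ Z := by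
  have h54 : (1:ℝ) < ((5/4 : ℝ) : ℂ).re := by rw [ofReal_re]; norm_num
  have hsum : Summable fun n => ‖LSeries.term 1 ((5/4 : ℝ) : ℂ) n‖ :=
    (LSeriesSummable_one_iff.mpr h54).norm
  have key : ∀ (f : ℕ → ℂ), (∀ n, ‖f n‖ ≤ 1) → ∀ s : ℂ, 5 / 4 ≤ s.re →
      ‖LSeries f s‖ ≤ ∑' n, ‖LSeries.term 1 ((5/4 : ℝ) : ℂ) n‖ := by
    intro f hf s hs
    refine tsum_of_norm_bounded hsum.hasSum fun n => ?_
    refine (LSeries.norm_term_le_of_re_le_re f (s := ((5/4 : ℝ) : ℂ)) (by simpa using hs) n).trans ?_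
    exact LSeries.norm_term_le _ (by simpa using hf n)
  refine ⟨max 1 (∑' n, ‖LSeries.term 1 ((5/4 : ℝ) : ℂ) n‖), le_max_left _ _, fun s hs => ⟨?_, ?_⟩⟩
  · rw [← LSeries_one_eq_riemannZeta (by linarith)]
    exact (key 1 (by simp) s hs).trans (le_max_right _ _)
  · have h := LSeries_one_mul_Lseries_moebius (s := s) (by linarith)
    rw [LSeries_one_eq_riemannZeta (by linarith)] at h
    rw [← eq_inv_of_mul_eq_one_right h]
    refine (key _ (fun n => ?_) s hs).trans (le_max_right _ _)
    rw [Complex.norm_intCast]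
    exact_mod_cast ArithmeticFunction.abs_moebius_le_one

lemma bc_bound {h : ℂ → ℂ} {R r A K : ℝ} (hr : 0 < r) (hrR : r < R) (hA : 0 < A)
    (hd : DifferentiableOn ℂ h (Metric.ball 0 R))
    (hre : ∀ z ∈ Metric.ball (0:ℂ) R, (h z).re ≤ A) (hK : ‖h 0‖ ≤ K) {z : ℂ} (hz : ‖z‖ ≤ r) :
    ‖h z‖ ≤ 2 * R / (R - r) * (A + K) := by
  have hK0 : 0 ≤ K := (norm_nonneg _).trans hK
  have hzR : z ∈ Metric.ball (0:ℂ) R := by rw [mem_ball_zero_iff]; linarith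
  refine (Complex.borelCaratheodory hA hd hre (by linarith) hzR).trans ?_
  have h1 : 0 < R - r := by linarith
  have h2 : 0 < R - ‖z‖ := by linarith
  have e : 2 * R / (R - r) * (A + K) = 2 * A * R / (R - r) + K * (2 * R) / (R - r) := by
    field_simp
  have hR0 : 0 < R := by linarith
  rw [e]
  refine add_le_add ?_ ?_
  · exact div_le_div₀ (by positivity) (by gcongr; linarith) h1 (by linarith)
  · exact div_le_div₀ (by positivity) (by gcongr; linarith) h1 (by linarith)

lemma zG_inv_bound
    (hRH : ∀ s : ℂ, riemannZeta s = 0 → 0 < s.re → s.re < 1 → s.re = 1 / 2)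
    {δ : ℝ} (hδ : 0 < δ) (hδ' : δ ≤ 1 / 2) :
    ∃ C : ℝ, 0 < C ∧ ∀ s : ℂ, 1 / 2 + δ ≤ s.re → s.re ≤ 2 →
      ‖(zG s)⁻¹‖ ≤ C * (1 + |s.im|) ^ (1 / 2 : ℝ) := by
  obtain ⟨Z, hZ1, hZ⟩ := zeta_consts
  set A := Real.log (2 * Z) with hAdef
  have hA : 0 < A := Real.log_pos (by linarith)
  set K := A + Real.pi with hKdef
  have hK : 0 < K := by positivity
  set r2 := 3 / 2 - δ with hr2
  set r3 := 3 / 2 - δ / 2 with hr3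
  set R := 3 / 2 - δ / 4 with hR
  set θ := (Real.log r2 - Real.log (1/2)) / (Real.log r3 - Real.log (1/2)) with hθ
  have hl12 : Real.log (1/2) < Real.log r2 := Real.log_lt_log (by norm_num) (by rw [hr2]; linarith)
  have hl23 : Real.log r2 < Real.log r3 :=
    Real.log_lt_log (by rw [hr2]; linarith) (by rw [hr2, hr3]; linarith)
  have hθ0 : 0 ≤ θ := div_nonneg (by linarith) (by linarith)
  have hθ1 : θ < 1 := by rw [hθ, div_lt_one (by linarith)]; linarith
  set D := 2 * R / (R - r3) + 6 with hD
  have hD0 : 0 < 2 * R / (R - r3) := div_pos (by rw [hR]; linarith) (by rw [hR, hr3]; linarith)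
  set M1 := 6 * (A + K) with hM1
  obtain ⟨C0, hC0⟩ := rpow_interp_le (θ := θ) (M1 := M1) (η := 1 / (2 * D)) hθ0 hθ1 (by positivity)
    (by positivity)
  refine ⟨Real.exp ((Real.log 6 + A + K) / 2 + C0), Real.exp_pos _, fun s hs1 hs2 => ?_⟩
  set T := s.im with hT
  set c : ℂ := ⟨2, T⟩ with hc
  have hballre : ∀ {ρ : ℝ} {z : ℂ}, z ∈ Metric.ball c ρ → 2 - ρ < z.re := by
    intro ρ z hz
    have := (Complex.abs_re_le_norm (z - c)).trans_lt (by simpa [dist_eq_norm] using hz)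
    rw [sub_re, abs_lt] at this
    have h2 : c.re = 2 := rfl
    linarith [this.1]
  have hR32 : R < 3 / 2 := by rw [hR]; linarith
  have hnz : ∀ z ∈ Metric.ball c R, zG z ≠ 0 := fun z hz =>
    zG_ne_zero hRH (by linarith [hballre hz])
  have hdf : DifferentiableOn ℂ zG (Metric.ball c R) := fun z hz => by
    refine (zG_diff ?_).differentiableWithinAt
    rintro rfl
    have := hballre hz
    simp at this; linarith
  obtain ⟨h, hhd, hh0, hhe⟩ := exists_local_log (by rw [hR]; linarith) hdf hnz
  have hre : ∀ z ∈ Metric.ball (0:ℂ) R, (h z).re = Real.log ‖zG (c + z)‖ := by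
    intro z hz
    rw [← hhe z hz, Complex.norm_exp, Real.log_exp]
  have hshift : ∀ {ρ : ℝ} {z : ℂ}, z ∈ Metric.ball (0:ℂ) ρ → c + z ∈ Metric.ball c ρ := by
    intro ρ z hz; simpa [Metric.mem_ball, dist_eq_norm] using hz
  -- upper bound on the half plane re ≥ 5/4
  have hup : ∀ w : ℂ, 5 / 4 ≤ w.re → ‖zG w‖ ≤ 2 * Z := by
    intro w hw
    have hw1 : w ≠ 1 := by rintro rfl; norm_num at hw
    have hwn : 1 ≤ ‖w‖ := by linarith [Complex.re_le_norm w]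
    rw [zG_eq hw1, norm_mul, norm_div, mul_comm 2 Z]
    refine mul_le_mul (hZ w hw).1 ?_ (by positivity) (by linarith)
    rw [div_le_iff₀ (by linarith)]
    have := norm_sub_le w 1
    rw [norm_one] at this
    linarith
  have hlow : ‖(zG c)⁻¹‖ ≤ 2 * Z := by
    have hcre : c.re = 2 := rfl
    have hc1 : c ≠ 1 := by intro h; rw [h] at hcre; norm_num at hcre
    have h1 : 1 ≤ ‖c - 1‖ := by
      have := Complex.re_le_norm (c - 1)
      rw [sub_re, hcre, one_re] at this
      linarith
    rw [zG_eq hc1, mul_inv, norm_mul, mul_comm 2 Z, inv_div, norm_div]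
    refine mul_le_mul (hZ c (by rw [hcre]; norm_num)).2 ?_ (by positivity) (by linarith)
    rw [div_le_iff₀ (by linarith)]
    have := norm_add_le (c - 1) 1
    rw [norm_one, sub_add_cancel] at this
    linarith
  have hcn : zG c ≠ 0 := hnz c (Metric.mem_ball_self (by rw [hR]; linarith))
  have hK0 : ‖h 0‖ ≤ K := by
    rw [hh0]
    refine (Complex.norm_le_abs_re_add_abs_im _).trans ?_
    rw [Complex.log_re, Complex.log_im, hKdef]
    refine add_le_add ?_ (Complex.abs_arg_le_pi _)
    have hp : 0 < ‖zG c‖ := norm_pos_iff.mpr hcn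
    rw [abs_le]
    constructor
    · rw [neg_le, ← Real.log_inv, ← norm_inv]
      exact Real.log_le_log (norm_pos_iff.mpr (inv_ne_zero hcn)) hlow
    · exact Real.log_le_log hp (hup c (by simp [hc]; norm_num))
  have hsub : Metric.ball (0:ℂ) (3/4) ⊆ Metric.ball 0 R :=
    Metric.ball_subset_ball (by rw [hR]; linarith)
  have hb1 : ∀ z : ℂ, ‖z‖ ≤ 1 / 2 → ‖h z‖ ≤ M1 := by
    intro z hz
    have := bc_bound (r := 1/2) (R := 3/4) (A := A) (K := K) (by norm_num) (by norm_num) hA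
      (hhd.mono hsub) (fun w hw => ?_) hK0 hz
    · refine this.trans (le_of_eq ?_)
      rw [hM1]; norm_num
    · rw [hre w (hsub hw)]
      refine Real.log_le_log (norm_pos_iff.mpr (hnz _ (hshift (hsub hw)))) (hup _ ?_)
      linarith [hballre (hshift hw)]
  set B := Real.log 6 + Real.log (1 + |T|) + A with hB
  have hl6 : 0 < Real.log 6 := Real.log_pos (by norm_num)
  have hlT : 0 ≤ Real.log (1 + |T|) := Real.log_nonneg (by linarith [abs_nonneg T])
  have hb3 : ∀ z : ℂ, ‖z‖ ≤ r3 → ‖h z‖ ≤ D * (B + K) := by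
    intro z hz
    have := bc_bound (r := r3) (R := R) (A := B) (K := K) (by rw [hr3]; linarith)
      (by rw [hr3, hR]; linarith) (by positivity) hhd (fun w hw => ?_) hK0 hz
    · refine this.trans ?_
      gcongr
      rw [hD]; linarith
    · rw [hre w hw]
      have hpos : 0 < ‖zG (c + w)‖ := norm_pos_iff.mpr (hnz _ (hshift hw))
      have hrw : 1 / 2 < (c + w).re := by linarith [hballre (hshift hw)]
      have hw' : ‖w‖ < R := by simpa using hw
      have h1 : ‖c + w - 1‖ ≤ 5 / 2 + |T| := by
        have e1 : c - 1 = (1:ℝ) + (T:ℝ) * I := by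
          apply Complex.ext <;> simp [hc]; norm_num
        have e2 : ‖c - 1‖ ≤ 1 + |T| := by
          rw [e1]
          refine (norm_add_le _ _).trans ?_
          simp
        have := norm_add_le (c - 1) w
        rw [show c - 1 + w = c + w - 1 by ring] at this
        linarith
      have h2 : ‖zG (c + w)‖ ≤ 6 * (1 + |T|) := by
        refine (zG_norm_le (by linarith)).trans ?_
        have : ‖c + w - 1‖ / (c + w).re ≤ (5 / 2 + |T|) / (1 / 2) := by gcongr
        have h3 := abs_nonneg T
        linarith
      have h3 := Real.log_le_log hpos h2
      rw [Real.log_mul (by norm_num) (by positivity)] at h3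
      linarith
  have hsz : ‖s - c‖ ≤ r2 := by
    have : s - c = ((s.re - 2 : ℝ) : ℂ) := by apply Complex.ext <;> simp [hc, hT]
    rw [this, Complex.norm_real, Real.norm_eq_abs, abs_le, hr2]
    constructor <;> linarith
  have hMM : M1 ≤ D * (B + K) := by
    rw [hM1]
    refine mul_le_mul (by rw [hD]; linarith) (by linarith) (by positivity) (by positivity)
  have hfin := three_circles (h := h) (R := R) (r1 := 1/2) (r2 := r2) (r3 := r3) (M1 := M1)
    (M3 := D * (B + K)) (by norm_num) (by rw [hr2]; linarith) (by rw [hr2, hr3]; linarith)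
    (by rw [hr3, hR]; linarith) hhd (by positivity) hMM hb1 hb3 hsz
  have hfin2 := hfin.trans (hC0 (D * (B + K)) (by positivity))
  have hsb : s - c ∈ Metric.ball (0:ℂ) R := by
    rw [mem_ball_zero_iff]; rw [hr2] at hsz; rw [hR]; linarith
  have e := hhe _ hsb
  rw [add_sub_cancel] at e
  rw [← e, ← Complex.exp_neg, Complex.norm_exp, neg_re]
  have h4 : -(h (s - c)).re ≤ ‖h (s - c)‖ := by
    have := Complex.abs_re_le_norm (h (s - c))
    linarith [neg_abs_le (h (s - c)).re]
  have hDne : D ≠ 0 := by rw [hD]; positivity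
  have h5 : 1 / (2 * D) * (D * (B + K)) = (B + K) / 2 := by field_simp
  rw [h5] at hfin2
  have h6 : (1 + |T|) ^ (1 / 2 : ℝ) = Real.exp (Real.log (1 + |T|) * (1 / 2)) :=
    Real.rpow_def_of_pos (by positivity) _
  rw [h6, ← Real.exp_add]
  apply Real.exp_le_exp.mpr
  rw [hB] at hfin2
  linarith


lemma bot_bigO {u : ℝ → ℂ} (hu : ContinuousOn u (Ici 0)) :
    u =O[nhdsWithin 0 (Ioi 0)] (fun x : ℝ => x ^ (-(0:ℝ))) := by
  have h : Tendsto u (nhdsWithin 0 (Ioi 0)) (nhds (u 0)) :=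
    (hu 0 self_mem_Ici).mono_left (nhdsWithin_mono _ Ioi_subset_Ici_self)
  simpa using h.isBigO_one ℝ

lemma locInt_of_cont {u : ℝ → ℂ} (hu : ContinuousOn u (Ici 0)) :
    LocallyIntegrableOn u (Ioi 0) :=
  (hu.mono Ioi_subset_Ici_self).locallyIntegrableOn measurableSet_Ioi

lemma mellinConv_of {u : ℝ → ℂ} {a : ℝ} (hu : ContinuousOn u (Ici 0))
    (hO : u =O[atTop] fun x : ℝ => x ^ (-a)) {s : ℂ} (h0 : 0 < s.re) (h1 : s.re < a) :
    MellinConvergent u s :=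
  mellinConvergent_of_isBigO_rpow (locInt_of_cont hu) hO h1 (bot_bigO hu) h0

lemma mellin_ibp {u u' : ℝ → ℂ} {a : ℝ} (hu : ContinuousOn u (Ici 0))
    (hu' : ContinuousOn u' (Ici 0)) (hd : ∀ x ∈ Ioi (0:ℝ), HasDerivAt u (u' x) x)
    (hO : u =O[atTop] fun x : ℝ => x ^ (-a)) (hO' : u' =O[atTop] fun x : ℝ => x ^ (-(a + 1)))
    {s : ℂ} (h0 : 0 < s.re) (h1 : s.re < a) :
    mellin u s = -(1 / s) * mellin u' (s + 1) := by
  have hs0 : s ≠ 0 := by rintro rfl; simp at h0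
  have c1 := mellinConv_of hu hO h0 h1
  have c2 := mellinConv_of (s := s + 1) hu' hO' (by simp; linarith) (by simp; linarith)
  have hv : ∀ x ∈ Ioi (0:ℝ), HasDerivAt (fun x : ℝ => (x:ℂ) ^ s / s) ((x:ℂ) ^ (s - 1)) x := by
    intro x hx
    have hx0 : x ≠ 0 := ne_of_gt hx
    have := (hasDerivAt_ofReal_cpow_const (r := s) hx0 hs0).div_const s
    rwa [mul_div_cancel_left₀ _ hs0] at this
  have := integral_Ioi_mul_deriv_eq_deriv_mul (a := (0:ℝ)) (u := u) (u' := u')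
    (v := fun x : ℝ => (x:ℂ) ^ s / s) (v' := fun x : ℝ => (x:ℂ) ^ (s - 1)) (a' := 0) (b' := 0)
    hd hv ?_ ?_ ?_ ?_
  · unfold mellin
    simp only [smul_eq_mul]
    rw [show (∫ t in Ioi (0:ℝ), (t:ℂ) ^ (s - 1) * u t) = ∫ t in Ioi (0:ℝ), u t * (t:ℂ) ^ (s - 1) by
      simp_rw [mul_comm], this, ← integral_const_mul]
    rw [sub_zero, zero_sub, ← integral_neg]
    congr 1
    ext x
    rw [add_sub_cancel_right]
    ring
  · refine c1.congr_fun (fun x _ => ?_) measurableSet_Ioi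
    simp [mul_comm]
  · have c3 : IntegrableOn (fun x : ℝ => 1 / s * ((x:ℂ) ^ (s + 1 - 1) • u' x)) (Ioi 0) :=
      Integrable.const_mul c2 (1 / s)
    refine c3.congr_fun (fun x _ => ?_) measurableSet_Ioi
    simp only [smul_eq_mul, add_sub_cancel_right, Pi.mul_apply]
    ring
  · have hb := bot_bigO hu
    have hO2 : (u * fun x : ℝ => (x:ℂ) ^ s / s) =O[nhdsWithin 0 (Ioi 0)]
        (fun x : ℝ => x ^ (-(0:ℝ)) * x ^ s.re) := by
      refine hb.mul (IsBigO.of_bound (1 / ‖s‖) ?_)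
      filter_upwards [self_mem_nhdsWithin] with x hx
      have hx' : (0:ℝ) < x := hx
      rw [norm_div, Complex.norm_cpow_eq_rpow_re_of_pos hx', Real.norm_eq_abs,
        abs_of_pos (by positivity)]
      apply le_of_eq; ring
    refine hO2.trans_tendsto ?_
    simp only [neg_zero, Real.rpow_zero, one_mul]
    have : Tendsto (fun x : ℝ => x ^ s.re) (nhds 0) (nhds ((0:ℝ) ^ s.re)) :=
      (Real.continuousAt_rpow_const 0 s.re (Or.inr h0.le))
    rw [Real.zero_rpow h0.ne'] at this
    exact this.mono_left nhdsWithin_le_nhds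
  · have hO2 : (u * fun x : ℝ => (x:ℂ) ^ s / s) =O[atTop]
        (fun x : ℝ => x ^ (-a) * x ^ s.re) := by
      refine hO.mul (IsBigO.of_bound (1 / ‖s‖) ?_)
      filter_upwards [eventually_gt_atTop 0] with x hx'
      rw [norm_div, Complex.norm_cpow_eq_rpow_re_of_pos hx', Real.norm_eq_abs,
        abs_of_pos (by positivity)]
      apply le_of_eq; ring
    refine hO2.trans_tendsto ?_
    have := tendsto_rpow_neg_atTop (y := a - s.re) (by linarith)
    refine this.congr' ?_
    filter_upwards [eventually_gt_atTop 0] with x hx'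
    rw [← Real.rpow_add hx']
    congr 1; ring

lemma muntz_data {α : ℝ} {f : ℝ → ℂ} (hf : MuntzClass α f) :
    ContinuousOn f (Ici 0) ∧ (f =O[atTop] fun x : ℝ => x ^ (-α)) ∧
    ∃ d1 d2 : ℝ → ℂ, ContinuousOn d1 (Ici 0) ∧ ContinuousOn d2 (Ici 0) ∧
      (∀ x ∈ Ioi (0:ℝ), HasDerivAt f (d1 x) x) ∧ (∀ x ∈ Ioi (0:ℝ), HasDerivAt d1 (d2 x) x) ∧
      (d1 =O[atTop] fun x : ℝ => x ^ (-(α + 1))) ∧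
      (d2 =O[atTop] fun x : ℝ => x ^ (-(α + 1 + 1))) := by
  obtain ⟨hc, hO⟩ := hf
  have huniq : UniqueDiffOn ℝ (Ici (0:ℝ)) := uniqueDiffOn_Ici 0
  refine ⟨hc.continuousOn, by simpa using hO 0 (by norm_num),
    iteratedDerivWithin 1 f (Ici 0), iteratedDerivWithin 2 f (Ici 0),
    hc.continuousOn_iteratedDerivWithin (by norm_num) huniq,
    hc.continuousOn_iteratedDerivWithin (by norm_num) huniq, ?_, ?_, by simpa using hO 1 (by norm_num), ?_⟩
  · intro x hx
    have hm : Ici (0:ℝ) ∈ nhds x := Ici_mem_nhds hx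
    have h1 : DifferentiableWithinAt ℝ f (Ici 0) x :=
      hc.differentiableOn (by norm_num) x (Ioi_subset_Ici_self hx)
    rw [iteratedDerivWithin_one]
    exact h1.hasDerivWithinAt.hasDerivAt hm
  · intro x hx
    have hm : Ici (0:ℝ) ∈ nhds x := Ici_mem_nhds hx
    have h1 : DifferentiableWithinAt ℝ (iteratedDerivWithin 1 f (Ici 0)) (Ici 0) x :=
      hc.differentiableOn_iteratedDerivWithin (by norm_num) huniq x (Ioi_subset_Ici_self hx)
    have e : iteratedDerivWithin 2 f (Ici 0) x =
        derivWithin (iteratedDerivWithin 1 f (Ici 0)) (Ici 0) x := by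
      rw [iteratedDerivWithin_succ]
    rw [e]
    exact h1.hasDerivWithinAt.hasDerivAt hm
  · have := hO 2 (by norm_num)
    refine this.congr_right fun x => ?_
    congr 1; push_cast; ring

lemma muntz_mellin_decay {α : ℝ} {f : ℝ → ℂ} (hf : MuntzClass α f) {a b : ℝ} (ha : 0 < a)
    (hb : b < α) :
    ∃ C : ℝ, 0 < C ∧ ∀ s : ℂ, a ≤ s.re → s.re ≤ b → ‖mellin f s‖ ≤ C / (1 + s.im ^ 2) := by
  obtain ⟨hfc, hfO, d1, d2, hc1, hc2, hD1, hD2, hO1, hO2⟩ := muntz_data hf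
  rcases lt_or_ge b a with hab | hab
  · exact ⟨1, one_pos, fun s h1 h2 => by linarith⟩
  have i1 : IntegrableOn (fun t : ℝ => t ^ (a + 1) * ‖d2 t‖) (Ioi 0) := by
    have := (mellinConv_of (s := ((a + 2 : ℝ) : ℂ)) hc2 hO2 (by simp; linarith) (by simp; linarith)).norm
    refine IntegrableOn.congr_fun this (fun t ht => ?_) measurableSet_Ioi
    simp only [norm_smul]
    rw [Complex.norm_cpow_eq_rpow_re_of_pos ht]
    congr 2
    simp; ring
  have i2 : IntegrableOn (fun t : ℝ => t ^ (b + 1) * ‖d2 t‖) (Ioi 0) := by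
    have := (mellinConv_of (s := ((b + 2 : ℝ) : ℂ)) hc2 hO2 (by simp; linarith) (by simp; linarith)).norm
    refine IntegrableOn.congr_fun this (fun t ht => ?_) measurableSet_Ioi
    simp only [norm_smul]
    rw [Complex.norm_cpow_eq_rpow_re_of_pos ht]
    congr 2
    simp; ring
  set C' := ∫ t in Ioi (0:ℝ), (t ^ (a + 1) * ‖d2 t‖ + t ^ (b + 1) * ‖d2 t‖) with hC'
  have hC'0 : 0 ≤ C' := by
    refine setIntegral_nonneg measurableSet_Ioi fun t ht => ?_
    have : (0:ℝ) < t := ht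
    positivity
  set m := min (a ^ 2) 1 with hm
  have hm0 : 0 < m := lt_min (by positivity) one_pos
  refine ⟨(C' + 1) / m, by positivity, fun s h1 h2 => ?_⟩
  have hs0 : s ≠ 0 := by rintro rfl; simp at h1; linarith
  have hs1 : s + 1 ≠ 0 := by
    intro h; have := congrArg Complex.re h; simp at this; linarith
  rw [mellin_ibp hfc hc1 hD1 hfO hO1 (by linarith) (by linarith),
    mellin_ibp (s := s + 1) hc1 hc2 hD2 hO1 hO2 (by simp; linarith) (by simp; linarith)]
  have hM : ‖mellin d2 (s + 1 + 1)‖ ≤ C' := by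
    refine norm_integral_le_of_norm_le (i1.add i2) ?_
    filter_upwards [ae_restrict_mem measurableSet_Ioi] with t ht
    have ht0 : (0:ℝ) < t := ht
    rw [norm_smul, Complex.norm_cpow_eq_rpow_re_of_pos ht0, ← add_mul]
    refine mul_le_mul_of_nonneg_right ?_ (norm_nonneg _)
    simp only [add_sub_cancel_right, add_re, one_re]
    rcases le_total 1 t with h | h
    · have : t ^ (s.re + 1) ≤ t ^ (b + 1) := Real.rpow_le_rpow_of_exponent_le h (by linarith)
      have : 0 ≤ t ^ (a + 1) := by positivity
      linarith
    · have : t ^ (s.re + 1) ≤ t ^ (a + 1) := Real.rpow_le_rpow_of_exponent_ge ht0 h (by linarith)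
      have : 0 ≤ t ^ (b + 1) := by positivity
      linarith
  have hn1 : m * (1 + s.im ^ 2) ≤ ‖s‖ ^ 2 := by
    rw [Complex.sq_norm, Complex.normSq_apply]
    have e1 : m ≤ a ^ 2 := min_le_left _ _
    have e2 : m ≤ 1 := min_le_right _ _
    have e3 : a ^ 2 ≤ s.re ^ 2 := by gcongr
    nlinarith [sq_nonneg s.im]
  have hn2 : ‖s‖ ≤ ‖s + 1‖ := by
    rw [← sq_le_sq₀ (norm_nonneg _) (norm_nonneg _), Complex.sq_norm, Complex.sq_norm,
      Complex.normSq_apply, Complex.normSq_apply]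
    simp only [add_re, one_re, add_im, one_im, add_zero]
    nlinarith
  have hsp : 0 < ‖s‖ := norm_pos_iff.mpr hs0
  have hn3 : m * (1 + s.im ^ 2) ≤ ‖s‖ * ‖s + 1‖ := by nlinarith
  have hq : 0 < 1 + s.im ^ 2 := by positivity
  rw [← mul_assoc, norm_mul, norm_mul, norm_neg, norm_neg, norm_div, norm_div, norm_one, div_div,
    div_mul_div_comm, one_mul, one_div_mul_eq_div]
  exact div_le_div₀ (by positivity) (by linarith) (by positivity) hn3

lemma contour_shift {g : ℂ → ℂ} {a b C r : ℝ} (hab : a ≤ b) (hr : 1 < r)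
    (hd : ∀ s : ℂ, a ≤ s.re → s.re ≤ b → DifferentiableAt ℂ g s)
    (hC : ∀ s : ℂ, a ≤ s.re → s.re ≤ b → ‖g s‖ ≤ C * (1 + |s.im|) ^ (-r)) :
    (∫ t : ℝ, g (a + t * I)) = ∫ t : ℝ, g (b + t * I) := by
  have hint : ∀ x : ℝ, a ≤ x → x ≤ b → Integrable (fun t : ℝ => g (x + t * I)) := by
    intro x h1 h2
    have hi : Integrable (fun t : ℝ => C * (1 + ‖t‖) ^ (-r)) :=
      (integrable_one_add_norm (by simpa using hr)).const_mul C
    refine hi.mono' ?_ (Eventually.of_forall fun t => ?_)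
    · refine Continuous.aestronglyMeasurable (continuous_iff_continuousAt.mpr fun t => ?_)
      have := (hd (x + t * I) (by simpa using h1) (by simpa using h2)).continuousAt
      exact ContinuousAt.comp (g := g) (f := fun t : ℝ => (x:ℂ) + t * I) this (by fun_prop)
    · have := hC (x + t * I) (by simpa using h1) (by simpa using h2)
      simpa using this
  have lim : ∀ x : ℝ, a ≤ x → x ≤ b → Tendsto (fun T : ℝ => ∫ t in (-T)..T, g (x + t * I)) atTop
      (nhds (∫ t : ℝ, g (x + t * I))) := fun x h1 h2 =>
    intervalIntegral_tendsto_integral (hint x h1 h2) tendsto_neg_atTop_atBot tendsto_id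
  have hbd : ∀ T : ℝ, 0 ≤ T → ‖(∫ t in (-T)..T, g (b + t * I)) - ∫ t in (-T)..T, g (a + t * I)‖ ≤
      2 * (b - a) * (C * (1 + T) ^ (-r)) := by
    intro T hT
    have hrect := Complex.integral_boundary_rect_eq_zero_of_differentiableOn g ⟨a, -T⟩ ⟨b, T⟩ ?_
    · have hh : ∀ y : ℝ, |y| = T → ‖∫ x in a..b, g (x + y * I)‖ ≤ (b - a) * (C * (1 + T) ^ (-r)) := by
        intro y hy
        have := intervalIntegral.norm_integral_le_of_norm_le_const (a := a) (b := b)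
          (f := fun x : ℝ => g (x + y * I)) (C := C * (1 + T) ^ (-r)) ?_
        · rw [abs_of_nonneg (by linarith)] at this
          linarith
        · intro x hx
          rw [uIoc_of_le hab] at hx
          have := hC (x + y * I) (by simpa using hx.1.le) (by simpa using hx.2)
          simpa [hy] using this
      have e1 := hh T (abs_of_nonneg hT)
      have e2 := hh (-T) (by rw [abs_neg, abs_of_nonneg hT])
      simp only [smul_eq_mul] at hrect
      have e3 : I * ((∫ t in (-T)..T, g (b + t * I)) - ∫ t in (-T)..T, g (a + t * I)) =
        (∫ x in a..b, g (x + T * I)) - ∫ x in a..b, g (x + (-T : ℝ) * I) := by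
        linear_combination hrect
      have e4 := congrArg norm e3
      rw [norm_mul, norm_I, one_mul] at e4
      rw [e4]
      refine (norm_sub_le _ _).trans ?_
      linarith
    · intro z hz
      rw [mem_reProdIm] at hz
      have h1 := hz.1
      simp only [uIcc_of_le hab] at h1
      exact (hd z h1.1 h1.2).differentiableWithinAt
  have l1 := (lim b hab le_rfl).sub (lim a le_rfl hab)
  have l2 : Tendsto (fun T : ℝ => 2 * (b - a) * (C * (1 + T) ^ (-r))) atTop (nhds 0) := by
    have h1 : Tendsto (fun T : ℝ => (1 + T) ^ (-r)) atTop (nhds 0) :=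
      (tendsto_rpow_neg_atTop (by linarith)).comp (tendsto_atTop_add_const_left _ _ tendsto_id)
    simpa using (h1.const_mul C).const_mul (2 * (b - a))
  have l3 := squeeze_zero_norm' ((eventually_ge_atTop 0).mono hbd) l2
  have := tendsto_nhds_unique l1 l3
  exact (sub_eq_zero.mp this).symm


lemma moebius_hasSum {s : ℂ} (hs : 1 < s.re) :
    HasSum (fun k : ℕ => (ArithmeticFunction.moebius (k + 1) : ℂ) * (((k + 1 : ℝ) : ℝ) : ℂ) ^ (-s))
      (riemannZeta s)⁻¹ := by
  have h := LSeries_one_mul_Lseries_moebius hs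
  rw [LSeries_one_eq_riemannZeta hs] at h
  have h1 : LSeriesHasSum (fun n => (ArithmeticFunction.moebius n : ℂ)) s (riemannZeta s)⁻¹ := by
    rw [← eq_inv_of_mul_eq_one_right h]
    exact (ArithmeticFunction.LSeriesSummable_moebius_iff.mpr hs).LSeriesHasSum
  have h2 := (hasSum_nat_add_iff' 1).mpr h1
  simp only [Finset.range_one, Finset.sum_singleton, LSeries.term_zero, sub_zero] at h2
  refine h2.congr_fun fun k => ?_
  rw [LSeries.term_of_ne_zero (by omega), cpow_neg, div_eq_mul_inv]
  push_cast
  rfl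

lemma moebius_line {α : ℝ} {f : ℝ → ℂ} (hf : MuntzClass α f) {y c : ℝ} (hy : 0 < y)
    (hc : 1 < c) (hcα : c < α) :
    (∑' k : ℕ, (ArithmeticFunction.moebius (k + 1) : ℂ) * f ((k + 1 : ℝ) * y)) =
      (2 * Real.pi)⁻¹ • ∫ t : ℝ, mellin f (c + t * I) * (y : ℂ) ^ (-(c + t * I : ℂ)) *
        (riemannZeta (c + t * I))⁻¹ := by
  obtain ⟨hfc, hfO, -⟩ := muntz_data hf
  obtain ⟨C, hC, hdec⟩ := muntz_mellin_decay hf (a := c) (b := c) (by linarith) hcα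
  have hdiff : ∀ s : ℂ, s.re = c → DifferentiableAt ℂ (mellin f) s := fun s hs =>
    mellin_differentiableAt_of_isBigO_rpow (locInt_of_cont hfc) hfO (by linarith) (bot_bigO hfc)
      (by linarith)
  have hcont : Continuous fun t : ℝ => mellin f (c + t * I) := by
    refine continuous_iff_continuousAt.mpr fun t => ?_
    have := (hdiff (c + t * I) (by simp)).continuousAt
    exact ContinuousAt.comp (g := mellin f) (f := fun t : ℝ => (c:ℂ) + t * I) this (by fun_prop)
  have hint : Integrable fun t : ℝ => mellin f (c + t * I) := by
    refine (integrable_inv_one_add_sq.const_mul C).mono' hcont.aestronglyMeasurable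
      (Eventually.of_forall fun t => ?_)
    have := hdec (c + t * I) (by simp) (by simp)
    simpa [div_eq_mul_inv] using this
  have hinv : ∀ k : ℕ, f ((k + 1 : ℝ) * y) = (2 * Real.pi)⁻¹ •
      ∫ t : ℝ, (((k + 1 : ℝ) * y : ℝ) : ℂ) ^ (-(c + t * I : ℂ)) * mellin f (c + t * I) := by
    intro k
    have hp : 0 < (k + 1 : ℝ) * y := by positivity
    have := mellinInv_mellin_eq c f hp (mellinConv_of hfc hfO (by simp; linarith) (by simpa using hcα))
      hint (hfc.continuousAt (Ici_mem_nhds hp))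
    rw [← this, mellinInv]
    simp only [smul_eq_mul, one_div]
  set G : ℕ → ℝ → ℂ := fun k t => (ArithmeticFunction.moebius (k + 1) : ℂ) *
    ((((k + 1 : ℝ) * y : ℝ) : ℂ) ^ (-(c + t * I : ℂ)) * mellin f (c + t * I)) with hG
  have hpos : ∀ k : ℕ, (0:ℝ) < k + 1 := fun k => by positivity
  have hGn : ∀ k t, ‖G k t‖ ≤ ((k + 1 : ℕ) : ℝ) ^ (-c) * (y ^ (-c) * ‖mellin f (c + t * I)‖) := by
    intro k t
    have hmu : ‖(ArithmeticFunction.moebius (k + 1) : ℂ)‖ ≤ 1 := by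
      rw [Complex.norm_intCast]
      exact_mod_cast ArithmeticFunction.abs_moebius_le_one
    rw [hG]
    simp only
    rw [norm_mul]
    refine (mul_le_of_le_one_left (norm_nonneg _) hmu).trans ?_
    rw [norm_mul, Complex.norm_cpow_eq_rpow_re_of_pos (mul_pos (hpos k) hy),
      Real.mul_rpow (hpos k).le hy.le]
    simp [mul_assoc]
  have hGc : ∀ k, Continuous (G k) := by
    intro k
    have h0 : (((k + 1 : ℝ) * y : ℝ) : ℂ) ≠ 0 := by
      exact_mod_cast (mul_pos (hpos k) hy).ne'
    refine continuous_const.mul (Continuous.mul ?_ hcont)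
    exact Continuous.const_cpow (by fun_prop) (Or.inl h0)
  have hGi : ∀ k, Integrable (G k) := fun k =>
    ((hint.norm.const_mul (y ^ (-c))).const_mul (((k + 1 : ℕ) : ℝ) ^ (-c))).mono'
      (hGc k).aestronglyMeasurable (Eventually.of_forall (hGn k))
  have hGs : Summable fun k => ∫ t, ‖G k t‖ := by
    have s1 : Summable fun n : ℕ => ((n + 1 : ℕ) : ℝ) ^ (-c) :=
      (summable_nat_add_iff 1).mpr (Real.summable_nat_rpow.mpr (by linarith))
    refine Summable.of_nonneg_of_le (fun k => integral_nonneg fun t => norm_nonneg _) (fun k => ?_)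
      (s1.mul_right (∫ t : ℝ, y ^ (-c) * ‖mellin f (c + t * I)‖))
    rw [← integral_const_mul]
    exact integral_mono (hGi k).norm
      ((hint.norm.const_mul (y ^ (-c))).const_mul (((k + 1 : ℕ) : ℝ) ^ (-c))) (hGn k)
  have hsw := integral_tsum_of_summable_integral_norm hGi hGs
  have hL : ∀ k : ℕ, (ArithmeticFunction.moebius (k + 1) : ℂ) * f ((k + 1 : ℝ) * y) =
      (2 * Real.pi)⁻¹ • ∫ t, G k t := by
    intro k
    rw [hinv k, hG]
    simp only
    rw [integral_const_mul, mul_smul_comm]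
  simp_rw [hL]
  rw [tsum_const_smul'', hsw]
  congr 2
  ext t
  have hm := (moebius_hasSum (s := c + t * I) (by simpa using hc)).mul_left
    (mellin f (c + t * I) * (y : ℂ) ^ (-(c + t * I : ℂ)))
  rw [← hm.tsum_eq]
  refine tsum_congr fun k => ?_
  rw [hG]
  simp only
  rw [ofReal_mul, Complex.mul_cpow_ofReal_nonneg (hpos k).le hy.le]
  ring

lemma moebius_inversion
    (hRH : ∀ s : ℂ, riemannZeta s = 0 → 0 < s.re → s.re < 1 → s.re = 1 / 2)
    {α : ℝ} (hα : 1 < α) {f : ℝ → ℂ} (hf : MuntzClass α f) {y σ : ℝ} (hy : 0 < y)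
    (hσ : 1 / 2 < σ) (hσ1 : σ < 1) :
    (∑' k : ℕ, (ArithmeticFunction.moebius (k + 1) : ℂ) * f ((k + 1 : ℝ) * y)) =
      lineIntegral (fun s => mellinT f s / riemannZeta s * (y : ℂ) ^ (-s)) σ := by
  obtain ⟨c, hc1, hc2⟩ := exists_between (lt_min hα one_lt_two)
  have hcα : c < α := hc2.trans_le (min_le_left _ _)
  have hc2' : c < 2 := hc2.trans_le (min_le_right _ _)
  rw [moebius_line hf hy hc1 hcα, lineIntegral]
  congr 1
  obtain ⟨hfc, hfO, -⟩ := muntz_data hf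
  obtain ⟨C, hC, hdec⟩ := muntz_mellin_decay hf (a := σ) (b := c) (by linarith) hcα
  obtain ⟨B, hB, hzb⟩ := zG_inv_bound hRH (δ := σ - 1 / 2) (by linarith) (by linarith)
  set g : ℂ → ℂ := fun s => mellin f s * (y : ℂ) ^ (-s) * ((s - 1) / s * (zG s)⁻¹) with hg
  have hgeq : ∀ s : ℂ, s ≠ 0 → s ≠ 1 →
      g s = mellin f s * (y : ℂ) ^ (-s) * (riemannZeta s)⁻¹ := by
    intro s h0 h1
    have : s - 1 ≠ 0 := sub_ne_zero.mpr h1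
    simp only [hg]
    rw [zG_eq h1, mul_inv, inv_div]
    congr 1
    field_simp
  have hy0 : (y : ℂ) ≠ 0 := by exact_mod_cast hy.ne'
  have hshift := contour_shift (g := g) (a := σ) (b := c) (r := 3 / 2)
    (C := 2 * C * (y ^ (-σ) + y ^ (-c)) * 3 * B) (by linarith) (by norm_num) ?_ ?_
  · calc _ = ∫ t : ℝ, g (c + t * I) := by
          congr 1; ext t
          refine (hgeq _ ?_ ?_).symm
          · intro h; have := congrArg Complex.re h; simp at this; linarith
          · intro h; have := congrArg Complex.re h; simp at this; linarith
      _ = ∫ t : ℝ, g (σ + t * I) := hshift.symm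
      _ = _ := by
          congr 1; ext t
          rw [hgeq]
          · rw [show mellinT f = mellin f from rfl]
            ring
          · intro h; have := congrArg Complex.re h; simp at this; linarith
          · intro h; have := congrArg Complex.re h; simp at this; linarith
  · intro s h1 h2
    have hs0 : s ≠ 0 := by rintro rfl; simp at h1; linarith
    have hm : DifferentiableAt ℂ (mellin f) s :=
      mellin_differentiableAt_of_isBigO_rpow (locInt_of_cont hfc) hfO (by linarith) (bot_bigO hfc)
        (by linarith)
    have hp : DifferentiableAt ℂ (fun s : ℂ => (y : ℂ) ^ (-s)) s :=
      differentiableAt_id.neg.const_cpow (Or.inl hy0)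
    have hq : DifferentiableAt ℂ (fun s : ℂ => (s - 1) / s) s :=
      (differentiableAt_id.sub_const 1).div differentiableAt_id hs0
    exact (hm.mul hp).mul (hq.mul ((zG_diff hs0).inv (zG_ne_zero hRH (by linarith))))
  · intro s h1 h2
    have hs0 : s ≠ 0 := by rintro rfl; simp at h1; linarith
    have b1 := hdec s h1 h2
    have b2 : ‖(y : ℂ) ^ (-s)‖ ≤ y ^ (-σ) + y ^ (-c) := by
      rw [Complex.norm_cpow_eq_rpow_re_of_pos hy, neg_re]
      have p1 : 0 ≤ y ^ (-σ) := by positivity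
      have p2 : 0 ≤ y ^ (-c) := by positivity
      rcases le_total 1 y with h | h
      · have : y ^ (-s.re) ≤ y ^ (-σ) := Real.rpow_le_rpow_of_exponent_le h (by linarith)
        linarith
      · have : y ^ (-s.re) ≤ y ^ (-c) := Real.rpow_le_rpow_of_exponent_ge hy h (by linarith)
        linarith
    have b3 : ‖(s - 1) / s‖ ≤ 3 := by
      have hn : 1 / 2 ≤ ‖s‖ := by
        have := Complex.re_le_norm s
        linarith
      rw [norm_div, div_le_iff₀ (by linarith)]
      have := norm_sub_le s 1
      rw [norm_one] at this
      linarith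
    have b4 := hzb s (by linarith) (by linarith)
    have b5 : C / (1 + s.im ^ 2) ≤ 2 * C * (1 + |s.im|) ^ (-2 : ℝ) := by
      rw [Real.rpow_neg (by positivity), show (2:ℝ) = ((2:ℕ):ℝ) by norm_num, Real.rpow_natCast,
        ← div_eq_mul_inv, div_le_div_iff₀ (by positivity) (by positivity)]
      have : (1 + |s.im|) ^ 2 ≤ 2 * (1 + s.im ^ 2) := by
        nlinarith [sq_abs s.im, sq_nonneg (|s.im| - 1)]
      push_cast
      nlinarith
    have b6 : (1 + |s.im|) ^ (-(3/2) : ℝ) = (1 + |s.im|) ^ (-2 : ℝ) * (1 + |s.im|) ^ (1/2 : ℝ) := by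
      rw [← Real.rpow_add (by positivity)]
      norm_num
    simp only [hg, norm_mul]
    rw [b6]
    calc _ ≤ (2 * C * (1 + |s.im|) ^ (-2 : ℝ)) * (y ^ (-σ) + y ^ (-c)) *
          (3 * (B * (1 + |s.im|) ^ (1/2 : ℝ))) := by
            gcongr
            exact b1.trans b5
      _ = _ := by ring


lemma sq_dvd_aux {k m k' m' : ℕ} (hk' : Squarefree k') (hm : m ≠ 0) (hm' : m' ≠ 0)
    (hk0 : k ≠ 0) (h : k * m ^ 2 = k' * m' ^ 2) : m ∣ m' := by
  rw [← Nat.factorization_le_iff_dvd hm hm']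
  intro p
  have h1 := congrArg (fun n => n.factorization p) h
  simp only [Nat.factorization_mul hk0 (pow_ne_zero 2 hm),
    Nat.factorization_mul hk'.ne_zero (pow_ne_zero 2 hm'), Nat.factorization_pow,
    Finsupp.add_apply, Finsupp.smul_apply, smul_eq_mul] at h1
  have h2 := hk'.natFactorization_le_one p
  omega

lemma sq_unique {k m k' m' : ℕ} (hk : Squarefree k) (hk' : Squarefree k') (hm : m ≠ 0)
    (hm' : m' ≠ 0) (h : k * m ^ 2 = k' * m' ^ 2) : m = m' ∧ k = k' := by
  have e : m = m' := Nat.dvd_antisymm (sq_dvd_aux hk' hm hm' hk.ne_zero h)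
    (sq_dvd_aux hk hm' hm hk'.ne_zero h.symm)
  subst e
  exact ⟨rfl, Nat.eq_of_mul_eq_mul_right (by positivity) h⟩

lemma liouville_decomp (h : ℕ → ℂ)
    (hs : Summable fun p : ℕ × ℕ => (ArithmeticFunction.moebius (p.2 + 1) : ℂ) *
      h ((p.2 + 1) * (p.1 + 1) ^ 2)) :
    (∑' n : ℕ, (-1 : ℂ) ^ (ArithmeticFunction.cardFactors (n + 1)) * h (n + 1)) =
      ∑' m : ℕ, ∑' k : ℕ, (ArithmeticFunction.moebius (k + 1) : ℂ) *
        h ((k + 1) * (m + 1) ^ 2) := by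
  rw [← hs.tsum_prod (f := fun p : ℕ × ℕ => (ArithmeticFunction.moebius (p.2 + 1) : ℂ) *
      h ((p.2 + 1) * (p.1 + 1) ^ 2))]
  have hsq : ∀ p : Function.support (fun p : ℕ × ℕ => (ArithmeticFunction.moebius (p.2 + 1) : ℂ) *
      h ((p.2 + 1) * (p.1 + 1) ^ 2)), Squarefree (p.1.2 + 1) := by
    rintro ⟨p, hp⟩
    have := left_ne_zero_of_mul hp
    rw [← ArithmeticFunction.moebius_ne_zero_iff_squarefree]
    exact_mod_cast this
  have hlam : ∀ k m : ℕ, Squarefree (k + 1) →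
      (-1 : ℂ) ^ (ArithmeticFunction.cardFactors ((k + 1) * (m + 1) ^ 2)) =
        (ArithmeticFunction.moebius (k + 1) : ℂ) := by
    intro k m hk
    rw [ArithmeticFunction.cardFactors_mul (by omega) (by positivity),
      ArithmeticFunction.cardFactors_pow, ArithmeticFunction.moebius_apply_of_squarefree hk,
      pow_add, pow_mul]
    simp
  have hpos : ∀ k m : ℕ, (k + 1) * (m + 1) ^ 2 - 1 + 1 = (k + 1) * (m + 1) ^ 2 := by
    intro k m
    exact Nat.sub_add_cancel (Nat.succ_le_of_lt (by positivity))
  refine tsum_eq_tsum_of_ne_zero_bij (fun p => (p.1.2 + 1) * (p.1.1 + 1) ^ 2 - 1) ?_ ?_ ?_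
  · intro p q hpq
    have h1 : (p.1.2 + 1) * (p.1.1 + 1) ^ 2 = (q.1.2 + 1) * (q.1.1 + 1) ^ 2 := by
      rw [← hpos, ← hpos]
      exact congrArg (· + 1) hpq
    obtain ⟨e1, e2⟩ := sq_unique (hsq p) (hsq q) (by omega) (by omega) h1
    ext <;> omega
  · intro n hn
    obtain ⟨a, b, ha, hb, hab, hsf⟩ := Nat.sq_mul_squarefree_of_pos (Nat.succ_pos n)
    obtain ⟨k, rfl⟩ : ∃ k, a = k + 1 := ⟨a - 1, by omega⟩
    obtain ⟨m, rfl⟩ : ∃ m, b = m + 1 := ⟨b - 1, by omega⟩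
    have hab' : (k + 1) * (m + 1) ^ 2 = n + 1 := by rw [mul_comm]; exact hab
    refine ⟨⟨(m, k), ?_⟩, ?_⟩
    · have h2 := right_ne_zero_of_mul hn
      simp only [Function.mem_support]
      rw [hab']
      refine mul_ne_zero ?_ h2
      exact_mod_cast ArithmeticFunction.moebius_ne_zero_iff_squarefree.mpr hsf
    · simp only
      omega
  · intro p
    rw [hpos, hlam _ _ (hsq p)]

lemma muntz_bound {α : ℝ} {f : ℝ → ℂ} (hα : 1 < α) (hfc : ContinuousOn f (Ici 0))
    (hO : f =O[atTop] fun x : ℝ => x ^ (-α)) :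
    ∃ C : ℝ, 0 ≤ C ∧ ∀ y : ℝ, 0 < y → ‖f y‖ ≤ C * y ^ (-α) := by
  obtain ⟨C, hC, hb⟩ := hO.exists_pos
  rw [IsBigOWith, eventually_atTop] at hb
  obtain ⟨A, hA⟩ := hb
  obtain ⟨D, hD⟩ := (isCompact_Icc (a := (0:ℝ)) (b := max A 1)).exists_bound_of_continuousOn
    (hfc.mono Icc_subset_Ici_self)
  have hD0 : 0 ≤ D := (norm_nonneg _).trans (hD 0 ⟨le_rfl, by positivity⟩)
  refine ⟨max C (D * (max A 1) ^ α), le_max_of_le_left hC.le, fun y hy => ?_⟩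
  rcases le_total A y with h | h
  · refine (hA y h).trans ?_
    rw [Real.norm_of_nonneg (by positivity)]
    gcongr
    exact le_max_left _ _
  · refine (hD y ⟨hy.le, h.trans (le_max_left _ _)⟩).trans ?_
    calc D = D * (y ^ α * y ^ (-α)) := by rw [← Real.rpow_add hy]; simp
      _ ≤ D * ((max A 1) ^ α * y ^ (-α)) := by
          gcongr
          exact h.trans (le_max_left _ _)
      _ = (D * (max A 1) ^ α) * y ^ (-α) := by ring
      _ ≤ _ := by
          gcongr
          exact le_max_right _ _

lemma muntz_summable {α : ℝ} {f : ℝ → ℂ} (hα : 1 < α) (hfc : ContinuousOn f (Ici 0))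
    (hO : f =O[atTop] fun x : ℝ => x ^ (-α)) {x : ℝ} (hx : 0 < x) :
    Summable fun p : ℕ × ℕ => (ArithmeticFunction.moebius (p.2 + 1) : ℂ) *
      f ((((p.2 + 1) * (p.1 + 1) ^ 2 : ℕ) : ℝ) * x) := by
  obtain ⟨C, hC, hb⟩ := muntz_bound hα hfc hO
  have s1 : Summable fun n : ℕ => ((n + 1 : ℕ) : ℝ) ^ (-α) :=
    (summable_nat_add_iff 1).mpr (Real.summable_nat_rpow.mpr (by linarith))
  have s2 : Summable fun p : ℕ × ℕ => ((p.1 + 1 : ℕ) : ℝ) ^ (-α) * ((p.2 + 1 : ℕ) : ℝ) ^ (-α) :=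
    s1.mul_of_nonneg s1 (fun _ => by positivity) (fun _ => by positivity)
  refine Summable.of_norm_bounded (s2.mul_left (C * x ^ (-α))) fun p => ?_
  have hmu : ‖(ArithmeticFunction.moebius (p.2 + 1) : ℂ)‖ ≤ 1 := by
    rw [Complex.norm_intCast]
    exact_mod_cast ArithmeticFunction.abs_moebius_le_one
  rw [norm_mul]
  refine (mul_le_of_le_one_left (norm_nonneg _) hmu).trans ?_
  refine (hb _ (by positivity)).trans ?_
  rw [Real.mul_rpow (by positivity) hx.le, Nat.cast_mul, Real.mul_rpow (by positivity) (by positivity)]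
  have h1 : (((p.1 + 1) ^ 2 : ℕ) : ℝ) ^ (-α) ≤ ((p.1 + 1 : ℕ) : ℝ) ^ (-α) := by
    refine Real.rpow_le_rpow_of_nonpos (by positivity) ?_ (by linarith)
    exact_mod_cast Nat.le_self_pow (by norm_num) _
  calc C * (((p.2 + 1 : ℕ) : ℝ) ^ (-α) * (((p.1 + 1) ^ 2 : ℕ) : ℝ) ^ (-α) * x ^ (-α))
      ≤ C * (((p.2 + 1 : ℕ) : ℝ) ^ (-α) * ((p.1 + 1 : ℕ) : ℝ) ^ (-α) * x ^ (-α)) := by gcongr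
    _ = _ := by ring

/-- a necessary condition for the Riemann hypothesis: under RH, a summation
formula for the operator with the Liouville function `λ(n) = (-1)^{Ω(n)}`. -/
theorem liouville_summation_of_RH
    (hRH : ∀ s : ℂ, riemannZeta s = 0 → 0 < s.re → s.re < 1 → s.re = 1 / 2) :
    ∀ α : ℝ, 1 < α → ∀ f : ℝ → ℂ, MuntzClass α f → ∀ x : ℝ, 0 < x →
      ∀ σ : ℝ, 1 / 2 < σ → σ < 1 →
        (∑' n : ℕ,
            (-1 : ℂ) ^ (ArithmeticFunction.cardFactors (n + 1)) * f ((n + 1 : ℝ) * x)) =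
          ∑' n : ℕ, lineIntegral
            (fun s => mellinT f s / riemannZeta s *
              (((n + 1 : ℝ) ^ 2 * x : ℝ) : ℂ) ^ (-s)) σ := by
  intro α hα f hf x hx σ hσ hσ1
  obtain ⟨hfc, hfO, -⟩ := muntz_data hf
  have h := liouville_decomp (fun n : ℕ => f ((n : ℝ) * x)) (muntz_summable hα hfc hfO hx)
  have e1 : (∑' n : ℕ,
      (-1 : ℂ) ^ (ArithmeticFunction.cardFactors (n + 1)) * f ((n + 1 : ℝ) * x)) =
      ∑' n : ℕ, (-1 : ℂ) ^ (ArithmeticFunction.cardFactors (n + 1)) *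
        f (((n + 1 : ℕ) : ℝ) * x) := by
    refine tsum_congr fun n => ?_
    push_cast
    rfl
  rw [e1]
  refine h.trans (tsum_congr fun m => ?_)
  rw [← moebius_inversion hRH hα hf (y := (m + 1 : ℝ) ^ 2 * x) (by positivity) hσ hσ1]
  refine tsum_congr fun k => ?_
  push_cast
  rw [mul_assoc]
end
end

section
/- Let α > 1 and let f belong to the Müntz class M_α. Then for all x > 0: Σ_{n : μ(n) ≠ 0} f(nx) = (3√2/(xπ√π)) (F_c f)(0) + Σ_{n=1}^∞ μ(n) [ (√(2π)/(n² x)) Σ_{m=1}^∞ (F_c f)(2πm/(n² x)) − (1/2) f(0) ]. -/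
open MeasureTheory Filter Asymptotics Set Complex

noncomputable section

lemma aux_integrable {g : ℝ → ℂ} {b : ℝ} (hb : 1 < b) (hc : ContinuousOn g (Ici 0))
    (ho : g =O[atTop] fun x : ℝ => x ^ (-b)) : IntegrableOn g (Ioi 0) := by
  have := (hc.locallyIntegrableOn measurableSet_Ici (μ := volume)).integrableOn_of_isBigO_atTop ho
    (integrableAtFilter_rpow_atTop_iff.mpr (by linarith))
  exact this.mono_set Ioi_subset_Ici_self

lemma aux_bound {f : ℝ → ℂ} {b : ℝ} (hb : 1 < b) (hc : ContinuousOn f (Ici 0))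
    (ho : f =O[atTop] fun x : ℝ => x ^ (-b)) :
    ∃ C : ℝ, 0 ≤ C ∧ ∀ t : ℝ, 0 < t → ‖f t‖ ≤ C * t ^ (-b) := by
  obtain ⟨c, hc0, hcb⟩ := ho.exists_nonneg
  obtain ⟨T, hT⟩ := eventually_atTop.mp hcb.bound
  obtain ⟨B, hB⟩ := (isCompact_Icc (a := (0:ℝ)) (b := max T 1)).exists_bound_of_continuousOn
    (hc.mono Icc_subset_Ici_self)
  have hB0 : 0 ≤ B := (norm_nonneg _).trans (hB 0 ⟨le_rfl, by positivity⟩)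
  refine ⟨c + B * (max T 1) ^ b, by positivity, fun t ht => ?_⟩
  have hp : (0:ℝ) < t ^ (-b) := Real.rpow_pos_of_pos ht _
  have hM : (0:ℝ) < max T 1 := by positivity
  rcases le_total t (max T 1) with h | h
  · have h1 := hB t ⟨ht.le, h⟩
    have h2 : 1 ≤ (max T 1) ^ b * t ^ (-b) := by
      rw [Real.rpow_neg ht.le, ← div_eq_mul_inv, le_div_iff₀ (Real.rpow_pos_of_pos ht _), one_mul]
      exact Real.rpow_le_rpow ht.le h (by linarith)
    calc ‖f t‖ ≤ B * 1 := by linarith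
      _ ≤ B * ((max T 1) ^ b * t ^ (-b)) := by gcongr
      _ ≤ _ := by
        have : 0 ≤ c * t ^ (-b) := by positivity
        nlinarith
  · have h1 := hT t ((le_max_left _ _).trans h)
    rw [Real.norm_of_nonneg hp.le] at h1
    have : 0 ≤ B * (max T 1) ^ b * t ^ (-b) := by positivity
    nlinarith

lemma aux_tendsto_zero {g : ℝ → ℂ} {b : ℝ} (hb : 0 < b)
    (ho : g =O[atTop] fun x : ℝ => x ^ (-b)) : Tendsto g atTop (nhds 0) :=
  ho.trans_tendsto (tendsto_rpow_neg_atTop hb)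

lemma aux_deriv (α : ℝ) (f : ℝ → ℂ) (hf : MuntzClass α f) :
    ∃ f1 f2 : ℝ → ℂ, ContinuousOn f (Ici 0) ∧ ContinuousOn f1 (Ici 0) ∧ ContinuousOn f2 (Ici 0) ∧
      (f =O[atTop] fun x : ℝ => x ^ (-α)) ∧ (f1 =O[atTop] fun x : ℝ => x ^ (-(α+1))) ∧
      (f2 =O[atTop] fun x : ℝ => x ^ (-(α+2))) ∧
      (∀ x ∈ Ioi (0:ℝ), HasDerivAt f (f1 x) x) ∧ (∀ x ∈ Ioi (0:ℝ), HasDerivAt f1 (f2 x) x) := by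
  obtain ⟨hd, hO⟩ := hf
  have hu := uniqueDiffOn_Ici (0:ℝ)
  refine ⟨iteratedDerivWithin 1 f (Ici 0), iteratedDerivWithin 2 f (Ici 0), hd.continuousOn,
    hd.continuousOn_iteratedDerivWithin (by norm_num) hu,
    hd.continuousOn_iteratedDerivWithin (by norm_num) hu, by simpa using hO 0 (by norm_num),
    by simpa using hO 1 (by norm_num), by simpa using hO 2 (by norm_num), ?_, ?_⟩
  · intro x hx
    have h1 := (hd.differentiableOn (by norm_num) x (mem_Ici.2 (le_of_lt hx))).hasDerivWithinAt
    have h2 := h1.hasDerivAt (Ici_mem_nhds hx)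
    rwa [iteratedDerivWithin_one]
  · intro x hx
    have h1 := (hd.differentiableOn_iteratedDerivWithin (m := 1) (by norm_num) hu x
      (mem_Ici.2 (le_of_lt hx))).hasDerivWithinAt
    have h2 := h1.hasDerivAt (Ici_mem_nhds hx)
    rw [show (2:ℕ) = 1 + 1 from rfl, iteratedDerivWithin_succ (n := 1)]
    exact h2

lemma aux_int_mul {g : ℝ → ℂ} {v : ℝ → ℂ} (hg : IntegrableOn g (Ioi 0)) (hv : Continuous v)
    {c : ℝ} (hb : ∀ t, ‖v t‖ ≤ c) : IntegrableOn (g * v) (Ioi 0) :=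
  Integrable.mul_bdd (c := c) hg hv.aestronglyMeasurable (Eventually.of_forall hb)

lemma aux_cos_decay (α : ℝ) (hα : 1 < α) (f : ℝ → ℂ) (hf : MuntzClass α f) :
    ∃ K : ℝ, ∀ ξ : ℝ, 0 < ξ →
      ‖∫ t in Ioi (0:ℝ), f t * (Real.cos (ξ * t) : ℂ)‖ ≤ K / ξ ^ 2 := by
  obtain ⟨f1, f2, c0, c1, c2, o0, o1, o2, d0, d1⟩ := aux_deriv α f hf
  have i0 := aux_integrable hα c0 o0
  have i1 := aux_integrable (by linarith) c1 o1
  have i2 := aux_integrable (by linarith) c2 o2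
  refine ⟨‖f1 0‖ + ∫ t in Ioi (0:ℝ), ‖f2 t‖, fun ξ hξ => ?_⟩
  have hξ' : (ξ : ℂ) ≠ 0 := by exact_mod_cast hξ.ne'
  have hsin : ∀ t : ℝ, ‖((Real.sin (ξ * t) / ξ : ℝ) : ℂ)‖ ≤ 1 / ξ := fun t => by
    rw [Complex.norm_real, Real.norm_eq_abs, abs_div, abs_of_pos hξ]
    gcongr
    exact Real.abs_sin_le_one _
  have hcos : ∀ t : ℝ, ‖((Real.cos (ξ * t) : ℝ) : ℂ)‖ ≤ 1 := fun t => by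
    rw [Complex.norm_real, Real.norm_eq_abs]
    exact Real.abs_cos_le_one _
  have hcos' : ∀ t : ℝ, ‖((-Real.cos (ξ * t) / ξ : ℝ) : ℂ)‖ ≤ 1 / ξ := fun t => by
    rw [Complex.norm_real, Real.norm_eq_abs, abs_div, abs_of_pos hξ, abs_neg]
    gcongr
    exact Real.abs_cos_le_one _
  have hsin' : ∀ t : ℝ, ‖((Real.sin (ξ * t) : ℝ) : ℂ)‖ ≤ 1 := fun t => by
    rw [Complex.norm_real, Real.norm_eq_abs]
    exact Real.abs_sin_le_one _
  have hv1 : ∀ t : ℝ, HasDerivAt (fun t : ℝ => ((Real.sin (ξ * t) / ξ : ℝ) : ℂ))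
      ((Real.cos (ξ * t) : ℝ) : ℂ) t := fun t => by
    refine HasDerivAt.ofReal_comp ?_
    exact ((((hasDerivAt_id' t).const_mul ξ).sin).div_const ξ).congr_deriv (by field_simp)
  have hv2 : ∀ t : ℝ, HasDerivAt (fun t : ℝ => ((-Real.cos (ξ * t) / ξ : ℝ) : ℂ))
      ((Real.sin (ξ * t) : ℝ) : ℂ) t := fun t => by
    refine HasDerivAt.ofReal_comp ?_
    exact ((((hasDerivAt_id' t).const_mul ξ).cos).neg.div_const ξ).congr_deriv (by field_simp)
  have lim : ∀ g : ℝ → ℂ, ContinuousOn g (Ici 0) → Tendsto g (nhdsWithin 0 (Ioi 0)) (nhds (g 0)) :=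
    fun g hg => (hg 0 (mem_Ici.2 le_rfl)).mono_left (nhdsWithin_mono _ Ioi_subset_Ici_self)
  have liminf : ∀ g v : ℝ → ℂ, ∀ c : ℝ, Tendsto g atTop (nhds 0) → (∀ t, ‖v t‖ ≤ c) →
      Tendsto (g * v) atTop (nhds 0) := fun g v c hg hv => by
    refine squeeze_zero_norm (a := fun t => ‖g t‖ * c) (fun t => ?_) ?_
    · rw [Pi.mul_apply, norm_mul]; gcongr; exact hv t
    · simpa using hg.norm.mul_const c
  have e1 := integral_Ioi_mul_deriv_eq_deriv_mul (a := 0) d0 (fun t _ => hv1 t)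
    (aux_int_mul i0 (by fun_prop) hcos) (aux_int_mul i1 (by fun_prop) hsin)
    ((lim f c0).mul (((hv1 0).continuousAt.tendsto).mono_left nhdsWithin_le_nhds))
    (liminf _ _ _ (aux_tendsto_zero (by linarith) o0) hsin)
  have e2 := integral_Ioi_mul_deriv_eq_deriv_mul (a := 0) d1 (fun t _ => hv2 t)
    (aux_int_mul i1 (by fun_prop) hsin') (aux_int_mul i2 (by fun_prop) hcos')
    ((lim f1 c1).mul (((hv2 0).continuousAt.tendsto).mono_left nhdsWithin_le_nhds))
    (liminf _ _ _ (aux_tendsto_zero (by linarith) o1) hcos')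
  have e3 : ∫ t in Ioi (0:ℝ), f1 t * ((Real.sin (ξ * t) / ξ : ℝ) : ℂ)
      = (∫ t in Ioi (0:ℝ), f1 t * ((Real.sin (ξ * t) : ℝ) : ℂ)) / ξ := by
    rw [← integral_div]
    congr 1 with t
    push_cast; ring
  have e4 : ∫ t in Ioi (0:ℝ), f2 t * ((-Real.cos (ξ * t) / ξ : ℝ) : ℂ)
      = -(∫ t in Ioi (0:ℝ), f2 t * ((Real.cos (ξ * t) : ℝ) : ℂ)) / ξ := by
    rw [← integral_neg, ← integral_div]
    congr 1 with t
    push_cast; ring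
  rw [e1, e3, e2, e4]
  have e5 : ‖∫ t in Ioi (0:ℝ), f2 t * ((Real.cos (ξ * t) : ℝ) : ℂ)‖ ≤ ∫ t in Ioi (0:ℝ), ‖f2 t‖ := by
    refine norm_integral_le_of_norm_le i2.norm (Eventually.of_forall fun t => ?_)
    rw [norm_mul]
    exact mul_le_of_le_one_right (norm_nonneg _) (hcos t)
  set I := ∫ t in Ioi (0:ℝ), f2 t * ((Real.cos (ξ * t) : ℝ) : ℂ)
  have e6 : (0 - f 0 * ((Real.sin (ξ * 0) / ξ : ℝ) : ℂ) -
      (0 - f1 0 * ((-Real.cos (ξ * 0) / ξ : ℝ) : ℂ) - -I / ξ) / ξ) = - (f1 0 + I) / (ξ:ℂ) ^ 2 := by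
    simp
    field_simp
    ring
  rw [e6, norm_div, norm_neg, norm_pow, Complex.norm_real, Real.norm_of_nonneg hξ.le]
  gcongr
  exact (norm_add_le _ _).trans (by gcongr)

lemma aux_split {h : ℝ → ℂ} (hi : Integrable h) :
    ∫ t, h t = ∫ t in Ioi (0:ℝ), (h (-t) + h t) := by
  have hn : Integrable (fun t => h (-t)) := hi.comp_neg
  rw [integral_add hn.integrableOn hi.integrableOn, integral_comp_neg_Ioi, neg_zero,
    intervalIntegral.integral_Iic_add_Ioi hi.integrableOn hi.integrableOn]

open FourierTransform in
lemma aux_poisson (α : ℝ) (hα : 1 < α) (f : ℝ → ℂ) (hf : MuntzClass α f) (y : ℝ) (hy : 0 < y) :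
    (∑' m : ℕ, f ((m + 1 : ℝ) * y)) = (y : ℂ)⁻¹ * (∫ t in Ioi (0:ℝ), f t) +
      (((Real.sqrt (2 * Real.pi) / y : ℝ) : ℂ) *
        (∑' m : ℕ, fourierCos f (2 * Real.pi * (m + 1 : ℝ) / y)) - (1 / 2) * f 0) := by
  obtain ⟨f1, f2, c0, -, -, o0, -, -, -, -⟩ := aux_deriv α f hf
  obtain ⟨K, hK⟩ := aux_cos_decay α hα f hf
  have hyC : (y : ℂ) ≠ 0 := by exact_mod_cast hy.ne'
  have hpi := Real.pi_pos
  set g : ℝ → ℂ := fun t => f (|t| * y) with hg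
  have gc : Continuous g := by
    refine c0.comp_continuous (by fun_prop) (fun t => ?_)
    exact mem_Ici.2 (by positivity)
  obtain ⟨C, hC0, hC⟩ := aux_bound hα c0 o0
  have gb : ∀ t : ℝ, t ≠ 0 → ‖g t‖ ≤ (C * y ^ (-α)) * |t| ^ (-α) := fun t ht => by
    refine (hC _ (by positivity)).trans (le_of_eq ?_)
    rw [Real.mul_rpow (abs_nonneg _) hy.le]; ring
  have go : g =O[cocompact ℝ] fun x : ℝ => |x| ^ (-α) := by
    refine IsBigO.of_bound (C * y ^ (-α)) ?_
    have : ({0}ᶜ : Set ℝ) ∈ cocompact ℝ := isCompact_singleton.compl_mem_cocompact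
    filter_upwards [this] with t ht
    rw [Real.norm_of_nonneg (by positivity)]
    exact gb t ht
  have gi : Integrable g := by
    refine (gc.locallyIntegrable).integrable_of_isBigO_atTop_of_norm_isNegInvariant
      (g := fun x : ℝ => x ^ (-α)) ?_ ?_ ?_
    · exact Eventually.of_forall fun t => by simp [g]
    · refine IsBigO.of_bound (C * y ^ (-α)) ?_
      filter_upwards [eventually_gt_atTop 0] with t ht
      rw [Real.norm_of_nonneg (by positivity)]
      simpa [abs_of_pos ht] using gb t ht.ne'
    · exact integrableAtFilter_rpow_atTop_iff.mpr (by linarith)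
  have gF : ∀ w : ℝ, 𝓕 g w =
      (2 / y : ℂ) * ∫ t in Ioi (0:ℝ), f t * (Real.cos (2 * Real.pi * w / y * t) : ℂ) := fun w => by
    rw [Real.fourier_real_eq_integral_exp_smul, aux_split]
    · have h1 := integral_comp_mul_left_Ioi
        (fun t => f t * (Real.cos (2 * Real.pi * w / y * t) : ℂ)) 0 hy
      rw [mul_zero] at h1
      rw [show (2 / y : ℂ) * (∫ t in Ioi (0:ℝ), f t * (Real.cos (2 * Real.pi * w / y * t) : ℂ)) =
        2 * (y⁻¹ • ∫ t in Ioi (0:ℝ), f t * (Real.cos (2 * Real.pi * w / y * t) : ℂ)) by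
          rw [Complex.real_smul]; push_cast; ring, ← h1, ← integral_const_mul]
      refine setIntegral_congr_fun measurableSet_Ioi fun t ht => ?_
      have ht' : |t| = t := abs_of_pos ht
      simp only [smul_eq_mul, hg, abs_neg, ht']
      rw [show 2 * Real.pi * w / y * (y * t) = 2 * Real.pi * w * t by field_simp, Complex.ofReal_cos,
        Complex.cos, mul_comm y t]
      rw [show ((-2 * Real.pi * -t * w : ℝ) : ℂ) = ((2 * Real.pi * w * t : ℝ) : ℂ) by
        push_cast; ring, show ((-2 * Real.pi * t * w : ℝ) : ℂ) = -((2 * Real.pi * w * t : ℝ) : ℂ) by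
        push_cast; ring]
      ring
    · refine Integrable.bdd_mul (c := 1) gi (by fun_prop) (Eventually.of_forall fun t => ?_)
      rw [Complex.norm_exp_ofReal_mul_I]
  have Fe : ∀ w : ℝ, 𝓕 g (-w) = 𝓕 g w := fun w => by
    rw [gF, gF]
    congr 2 with t
    rw [show 2 * Real.pi * -w / y * t = -(2 * Real.pi * w / y * t) by ring, Real.cos_neg]
  have Fb : ∀ w : ℝ, 0 < w → ‖𝓕 g w‖ ≤ (2 / y * K / (2 * Real.pi / y) ^ 2) * |w| ^ (-2 : ℝ) := by
    intro w hw
    rw [gF, norm_mul]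
    have := hK (2 * Real.pi * w / y) (by positivity)
    have e : ‖(2 / y : ℂ)‖ = 2 / y := by
      rw [norm_div, Complex.norm_real, Real.norm_of_nonneg hy.le]; simp
    rw [e, abs_of_pos hw, Real.rpow_neg hw.le, Real.rpow_two]
    calc _ ≤ 2 / y * (K / (2 * Real.pi * w / y) ^ 2) := by gcongr
      _ = _ := by field_simp
  have Fo : Summable fun n : ℤ => 𝓕 g n := by
    have hs := (Real.summable_abs_int_rpow (b := 2) one_lt_two).mul_left
      (2 / y * K / (2 * Real.pi / y) ^ 2)
    refine Summable.of_norm_bounded_eventually hs ?_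
    have : ({0}ᶜ : Set ℤ) ∈ cofinite := (finite_singleton 0).compl_mem_cofinite
    filter_upwards [this] with n hn
    have hn : (n : ℝ) ≠ 0 := by exact_mod_cast hn
    rcases lt_or_gt_of_ne hn with h | h
    · have := Fb (-n) (by linarith)
      rwa [Fe, abs_neg] at this
    · exact Fb n h
  have P := Real.tsum_eq_tsum_fourier_of_rpow_decay_of_summable gc hα go Fo 0
  have gs : Summable fun n : ℤ => g n := by
    have hs := (Real.summable_abs_int_rpow (b := α) hα).mul_left (C * y ^ (-α))
    refine Summable.of_norm_bounded_eventually hs ?_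
    have : ({0}ᶜ : Set ℤ) ∈ cofinite := (finite_singleton 0).compl_mem_cofinite
    filter_upwards [this] with n hn
    exact gb n (by exact_mod_cast hn)
  have P' : ∑' n : ℤ, g n = ∑' n : ℤ, 𝓕 g n := by simpa using P
  rw [tsum_int_eq_zero_add_two_mul_tsum_pnat (f := fun n : ℤ => g n) (fun n => by simp [g]) gs,
    tsum_int_eq_zero_add_two_mul_tsum_pnat (f := fun n : ℤ => 𝓕 g n)
      (fun n => by simpa using Fe n) Fo] at P'
  simp only [Int.cast_natCast] at P'
  rw [tsum_pnat_eq_tsum_succ (f := fun n : ℕ => g n),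
    tsum_pnat_eq_tsum_succ (f := fun n : ℕ => 𝓕 g n)] at P'
  have l1 : ∀ m : ℕ, g ((m + 1 : ℕ) : ℝ) = f ((m + 1 : ℝ) * y) := fun m => by
    simp only [hg]
    rw [abs_of_nonneg (by positivity)]; push_cast; rfl
  have sq : ((Real.sqrt (2 * Real.pi) / y : ℝ) : ℂ) * (Real.sqrt (2 / Real.pi) : ℂ) = 2 / y := by
    rw [← Complex.ofReal_mul, div_mul_eq_mul_div, ← Real.sqrt_mul (by positivity),
      show 2 * Real.pi * (2 / Real.pi) = 2 ^ 2 by field_simp, Real.sqrt_sq (by norm_num)]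
    push_cast; rfl
  have l2 : ∀ m : ℕ, 𝓕 g ((m + 1 : ℕ) : ℝ) =
      ((Real.sqrt (2 * Real.pi) / y : ℝ) : ℂ) * fourierCos f (2 * Real.pi * (m + 1 : ℝ) / y) :=
    fun m => by
      rw [gF, fourierCos, ← mul_assoc, sq]; push_cast; rfl
  have l3 : 𝓕 g 0 = (2 / y : ℂ) * ∫ t in Ioi (0:ℝ), f t := by
    rw [gF]; simp
  simp only [l1, l2] at P'
  rw [tsum_mul_left] at P'
  simp only [Int.cast_zero, l3] at P'
  have g0 : g 0 = f 0 := by simp [g]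
  rw [g0] at P'
  simp only [nsmul_eq_mul, Nat.cast_ofNat] at P'
  linear_combination P' / 2

lemma aux_sq_dvd {a b d : ℕ} (hb : 0 < b) (ha : Squarefree a) : d ^ 2 ∣ b ^ 2 * a ↔ d ∣ b := by
  constructor
  · intro h
    obtain ⟨g, d', b', hg, hco, rfl, rfl⟩ := Nat.exists_coprime' (m := d) (n := b)
      (Nat.gcd_pos_of_pos_right _ hb)
    have h1 : d' ^ 2 * g ^ 2 ∣ (b' ^ 2 * a) * g ^ 2 := by
      convert h using 1 <;> ring
    have h2 := Nat.dvd_of_mul_dvd_mul_right (by positivity) h1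
    have h3 := (Nat.Coprime.pow 2 2 hco).dvd_of_dvd_mul_left h2
    rw [sq] at h3
    have h4 := Nat.isUnit_iff.1 (ha d' h3)
    rw [h4, one_mul]
    exact Dvd.intro_left _ rfl
  · intro h
    exact (pow_dvd_pow_of_dvd h 2).mul_right _

lemma aux_moebius_sum (n : ℕ) :
    (∑' d : ℕ, if (d + 1) ^ 2 ∣ n + 1 then (ArithmeticFunction.moebius (d + 1) : ℂ) else 0) =
      if ArithmeticFunction.moebius (n + 1) ≠ 0 then 1 else 0 := by
  obtain ⟨a, b, ha, hb, hab, hsq⟩ := Nat.sq_mul_squarefree_of_pos (Nat.succ_pos n)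
  have hab' : n + 1 = b ^ 2 * a := hab.symm
  have h1 : ∀ d : ℕ, (if (d + 1) ^ 2 ∣ n + 1 then (ArithmeticFunction.moebius (d + 1) : ℂ) else 0)
      = (fun k : ℕ => if k ∣ b then (ArithmeticFunction.moebius k : ℂ) else 0) (d + 1) := fun d => by
    simp only [hab', aux_sq_dvd hb hsq]
  rw [tsum_congr h1]
  have h2 : (∑' d : ℕ, (fun k : ℕ => if k ∣ b then (ArithmeticFunction.moebius k : ℂ) else 0) (d + 1))
      = ∑ k ∈ b.divisors, (ArithmeticFunction.moebius k : ℂ) := by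
    have hs : Summable (fun k : ℕ => if k ∣ b then (ArithmeticFunction.moebius k : ℂ) else 0) := by
      refine summable_of_ne_finset_zero (s := b.divisors) fun k hk => if_neg fun h => hk ?_
      exact Nat.mem_divisors.2 ⟨h, hb.ne'⟩
    have h3 := hs.tsum_eq_zero_add
    rw [tsum_eq_sum (s := b.divisors) (fun k hk => if_neg fun h => hk
      (Nat.mem_divisors.2 ⟨h, hb.ne'⟩))] at h3
    simp only [ArithmeticFunction.map_zero, Int.cast_zero, ite_self, zero_add] at h3
    rw [← h3]
    exact Finset.sum_congr rfl fun k hk => if_pos (Nat.dvd_of_mem_divisors hk)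
  rw [h2]
  have h4 : ∑ k ∈ b.divisors, (ArithmeticFunction.moebius k : ℂ) = if b = 1 then 1 else 0 := by
    have h5 := congrArg (fun F : ArithmeticFunction ℤ => F b)
      ArithmeticFunction.coe_zeta_mul_moebius
    simp only [ArithmeticFunction.coe_zeta_mul_apply, ArithmeticFunction.one_apply] at h5
    exact_mod_cast congrArg (fun z : ℤ => (z : ℂ)) h5
  rw [h4]
  congr 1
  rw [ArithmeticFunction.moebius_ne_zero_iff_squarefree, hab']
  apply propext
  constructor
  · rintro rfl; simpa using hsq
  · intro h
    have := h b ⟨a, by ring⟩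
    simpa using this

lemma aux_moebius_norm (n : ℕ) : ‖(ArithmeticFunction.moebius n : ℂ)‖ ≤ 1 := by
  rw [Complex.norm_intCast]
  exact_mod_cast ArithmeticFunction.abs_moebius_le_one

lemma aux_moebius_two :
    ∑' n : ℕ, (ArithmeticFunction.moebius (n + 1) : ℂ) * (((n + 1 : ℝ) ^ 2 : ℝ) : ℂ)⁻¹
      = 6 / (Real.pi : ℂ) ^ 2 := by
  have h := LSeries_one_mul_Lseries_moebius (s := 2) (by simp)
  rw [LSeries_one_eq_riemannZeta (by simp), riemannZeta_two] at h
  have hs := (ArithmeticFunction.LSeriesSummable_moebius_iff (s := 2)).2 (by simp)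
  have e : LSeries (fun n => (ArithmeticFunction.moebius n : ℂ)) 2 =
      ∑' n : ℕ, (ArithmeticFunction.moebius (n + 1) : ℂ) * (((n + 1 : ℝ) ^ 2 : ℝ) : ℂ)⁻¹ := by
    rw [LSeries, Summable.tsum_eq_zero_add hs]
    simp only [LSeries.term_zero, zero_add]
    refine tsum_congr fun n => ?_
    rw [LSeries.term_of_ne_zero (by omega), div_eq_mul_inv]
    congr 2
    push_cast
    norm_cast
  rw [e] at h
  have hpi : (Real.pi : ℂ) ≠ 0 := by exact_mod_cast Real.pi_ne_zero
  field_simp at h ⊢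
  linear_combination h

/-- the double sum -/
lemma aux_double (α : ℝ) (hα : 1 < α) (f : ℝ → ℂ) (C : ℝ)
    (hC : ∀ t : ℝ, 0 < t → ‖f t‖ ≤ C * t ^ (-α)) (x : ℝ) (hx : 0 < x) :
    Summable (fun d : ℕ => (ArithmeticFunction.moebius (d + 1) : ℂ) *
        ∑' m : ℕ, f ((m + 1 : ℝ) * ((d + 1 : ℝ) ^ 2 * x))) ∧
    (∑' n : ℕ, if ArithmeticFunction.moebius (n + 1) ≠ 0 then f ((n + 1 : ℝ) * x) else 0) =
      ∑' d : ℕ, (ArithmeticFunction.moebius (d + 1) : ℂ) *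
        ∑' m : ℕ, f ((m + 1 : ℝ) * ((d + 1 : ℝ) ^ 2 * x)) := by
  set F : ℕ × ℕ → ℂ := fun p => (ArithmeticFunction.moebius (p.1 + 1) : ℂ) *
    f ((p.2 + 1 : ℝ) * ((p.1 + 1 : ℝ) ^ 2 * x)) with hF
  have hs1 : ∀ b : ℝ, 1 < b → Summable fun n : ℕ => (n + 1 : ℝ) ^ (-b) := fun b hb => by
    have := (summable_nat_add_iff 1).2 (Real.summable_nat_rpow.2 (by linarith : -b < -1))
    simpa using this
  have Fs : Summable F := by
    have hprod := ((hs1 (2 * α) (by linarith)).mul_of_nonneg (hs1 α hα)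
      (fun n => by positivity) (fun n => by positivity)).mul_left (C * x ^ (-α))
    refine Summable.of_norm_bounded hprod fun p => ?_
    simp only [hF, norm_mul]
    have h1 := aux_moebius_norm (p.1 + 1)
    have h2 := hC ((p.2 + 1 : ℝ) * ((p.1 + 1 : ℝ) ^ 2 * x)) (by positivity)
    have h3 : ((p.2 + 1 : ℝ) * ((p.1 + 1 : ℝ) ^ 2 * x)) ^ (-α) =
        x ^ (-α) * ((p.1 + 1 : ℝ) ^ (-(2 * α)) * (p.2 + 1 : ℝ) ^ (-α)) := by
      rw [Real.mul_rpow (by positivity) (by positivity), Real.mul_rpow (by positivity) hx.le,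
        ← Real.rpow_natCast_mul (by positivity)]
      push_cast
      rw [show (2:ℝ) * -α = -(2 * α) by ring]
      ring
    rw [h3] at h2
    calc _ ≤ 1 * (C * (x ^ (-α) * ((p.1 + 1 : ℝ) ^ (-(2 * α)) * (p.2 + 1 : ℝ) ^ (-α)))) :=
          mul_le_mul h1 h2 (norm_nonneg _) zero_le_one
      _ = _ := by ring
  have hinner : ∀ d : ℕ, (∑' m : ℕ, F (d, m)) = (ArithmeticFunction.moebius (d + 1) : ℂ) *
        ∑' m : ℕ, f ((m + 1 : ℝ) * ((d + 1 : ℝ) ^ 2 * x)) := fun d => by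
    simp only [hF]; rw [tsum_mul_left]
  refine ⟨Fs.prod.congr fun d => (hinner d), ?_⟩
  set G : ℕ × ℕ → ℂ := fun p => if (p.1 + 1) ^ 2 ∣ p.2 + 1 then
    (ArithmeticFunction.moebius (p.1 + 1) : ℂ) * f ((p.2 + 1 : ℝ) * x) else 0 with hG
  let φ : ℕ × ℕ → ℕ × ℕ := fun p => (p.1, (p.2 + 1) * (p.1 + 1) ^ 2 - 1)
  have hφ : ∀ p : ℕ × ℕ, (p.2 + 1) * (p.1 + 1) ^ 2 - 1 + 1 = (p.2 + 1) * (p.1 + 1) ^ 2 := fun p =>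
    Nat.sub_add_cancel (Nat.succ_le_of_lt (by positivity))
  have hinj : Function.Injective φ := by
    rintro ⟨d, m⟩ ⟨d', m'⟩ h
    simp only [φ, Prod.mk.injEq] at h
    obtain ⟨rfl, h⟩ := h
    have h1 := hφ (d, m)
    have h2 := hφ (d, m')
    simp only at h1 h2
    rw [h, h2] at h1
    have := Nat.eq_of_mul_eq_mul_right (by positivity) h1
    simp only [Prod.mk.injEq, true_and]; omega
  have hGF : ∀ p, G (φ p) = F p := fun p => by
    have h1 := hφ p
    simp only [hG, hF, φ]
    rw [h1, if_pos (Dvd.intro_left _ rfl)]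
    have h2 : (((p.2 + 1) * (p.1 + 1) ^ 2 - 1 : ℕ) : ℝ) + 1 = (p.2 + 1 : ℝ) * (p.1 + 1 : ℝ) ^ 2 := by
      exact_mod_cast congrArg (fun k : ℕ => (k : ℝ)) h1
    rw [h2, mul_assoc]
  have hrange : ∀ p, p ∉ Set.range φ → G p = 0 := by
    rintro ⟨d, n⟩ hp
    refine if_neg fun h => hp ?_
    obtain ⟨k, hk⟩ := h
    simp only at hk
    rcases k with _ | k
    · simp at hk
    · refine ⟨(d, k), ?_⟩
      simp only [φ, Prod.mk.injEq, true_and]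
      rw [mul_comm, ← hk]; rfl
  have hGFc : G ∘ φ = F := funext hGF
  have Gs : Summable G := by
    rw [← hinj.summable_iff hrange, hGFc]; exact Fs
  have key : (∑' p, G p) = ∑' p, F p := by
    rw [← hGFc]
    refine (hinj.tsum_eq ?_).symm
    intro p hp
    by_contra h
    exact hp (hrange p h)
  rw [← tsum_congr hinner, ← Fs.tsum_prod, ← key]
  have hsw : (∑' p, G p) = ∑' (n : ℕ) (d : ℕ), G (d, n) := by
    rw [Gs.tsum_prod]
    exact (Summable.tsum_comm (f := fun d n => G (d, n)) Gs).symm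
  rw [hsw]
  refine tsum_congr fun n => ?_
  have h6 : ∀ d : ℕ, G (d, n) = (if (d + 1) ^ 2 ∣ n + 1 then
      (ArithmeticFunction.moebius (d + 1) : ℂ) else 0) * f ((n + 1 : ℝ) * x) := fun d => by
    simp only [hG, ite_mul, zero_mul]
  rw [tsum_congr h6, tsum_mul_right, aux_moebius_sum, ite_mul, one_mul, zero_mul]

/-- Poisson type summation formula for the sum over squarefree integers in terms
of the Fourier cosine transform. -/
theorem poisson_type_squarefree_fourier (α : ℝ) (hα : 1 < α) (f : ℝ → ℂ)
    (hf : MuntzClass α f) :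
    ∀ x : ℝ, 0 < x →
      (∑' n : ℕ, if ArithmeticFunction.moebius (n + 1) ≠ 0 then f ((n + 1 : ℝ) * x) else 0) =
        ((3 * Real.sqrt 2 / (x * Real.pi * Real.sqrt Real.pi) : ℝ) : ℂ) * fourierCos f 0 +
          ∑' n : ℕ, (ArithmeticFunction.moebius (n + 1) : ℂ) *
            (((Real.sqrt (2 * Real.pi) / ((n + 1 : ℝ) ^ 2 * x) : ℝ) : ℂ) *
                (∑' m : ℕ, fourierCos f (2 * Real.pi * (m + 1 : ℝ) / ((n + 1 : ℝ) ^ 2 * x))) -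
              (1 / 2) * f 0) := by
  intro x hx
  obtain ⟨f1, f2, c0, -, -, o0, -, -, -, -⟩ := aux_deriv α f hf
  obtain ⟨C, -, hC⟩ := aux_bound hα c0 o0
  obtain ⟨hs, he⟩ := aux_double α hα f C hC x hx
  rw [he]
  have hpi : (Real.pi : ℂ) ≠ 0 := by exact_mod_cast Real.pi_ne_zero
  have hxC : (x : ℂ) ≠ 0 := by exact_mod_cast hx.ne'
  set I := ∫ t in Ioi (0:ℝ), f t with hI
  have hterm : ∀ n : ℕ, (ArithmeticFunction.moebius (n + 1) : ℂ) *
            (((Real.sqrt (2 * Real.pi) / ((n + 1 : ℝ) ^ 2 * x) : ℝ) : ℂ) *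
                (∑' m : ℕ, fourierCos f (2 * Real.pi * (m + 1 : ℝ) / ((n + 1 : ℝ) ^ 2 * x))) -
              (1 / 2) * f 0) =
      (ArithmeticFunction.moebius (n + 1) : ℂ) *
        (∑' m : ℕ, f ((m + 1 : ℝ) * ((n + 1 : ℝ) ^ 2 * x))) -
      ((ArithmeticFunction.moebius (n + 1) : ℂ) * (((n + 1 : ℝ) ^ 2 : ℝ) : ℂ)⁻¹) *
        ((x : ℂ)⁻¹ * I) := fun n => by
    rw [aux_poisson α hα f hf ((n + 1 : ℝ) ^ 2 * x) (by positivity), Complex.ofReal_mul, mul_inv]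
    ring
  have hms : Summable fun n : ℕ =>
      (ArithmeticFunction.moebius (n + 1) : ℂ) * (((n + 1 : ℝ) ^ 2 : ℝ) : ℂ)⁻¹ := by
    by_contra h
    have := aux_moebius_two
    rw [tsum_eq_zero_of_not_summable h] at this
    exact (div_ne_zero (by norm_num) (pow_ne_zero 2 hpi)) this.symm
  rw [tsum_congr hterm, (hs.tsum_sub (hms.mul_right _)), tsum_mul_right, aux_moebius_two]
  have hF : fourierCos f 0 = (Real.sqrt (2 / Real.pi) : ℂ) * I := by
    simp [fourierCos, hI]
  have hk : (3 * Real.sqrt 2 / (x * Real.pi * Real.sqrt Real.pi)) * Real.sqrt (2 / Real.pi)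
      = 6 / Real.pi ^ 2 * x⁻¹ := by
    have hp := Real.pi_pos
    have h1 : Real.sqrt 2 * Real.sqrt 2 = 2 := Real.mul_self_sqrt (by norm_num)
    have h2 : Real.sqrt Real.pi * Real.sqrt Real.pi = Real.pi := Real.mul_self_sqrt hp.le
    have h3 : Real.sqrt Real.pi ≠ 0 := (Real.sqrt_pos.2 hp).ne'
    rw [Real.sqrt_div (by norm_num)]
    calc _ = 3 * (Real.sqrt 2 * Real.sqrt 2) /
          (x * Real.pi * (Real.sqrt Real.pi * Real.sqrt Real.pi)) := by field_simp
      _ = _ := by rw [h1, h2]; field_simp; norm_num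
  have hk' := congrArg (fun r : ℝ => (r : ℂ)) hk
  simp only [Complex.ofReal_mul] at hk'
  rw [hF, ← mul_assoc, hk']
  push_cast
  ring
end
end
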